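/- Let R be a commutative Noetherian semiperfect ring, C a semidualizing R-module, n a positive integer, and M a finitely generated R-module in the Bass class B_C which is horizontally linked with respect to C. Consider: (i) Ext^i_{P_C}(λ_R(C,M), C) = 0 for 0 < i < n (equivalently, Ext^i_R(Hom_R(C, λ_R(C,M)), R) = 0 for 0 < i < n); (ii) M is an n-th C-syzygy module; (iii) M satisfies (S̃_n). Then: (a) (i) ⇒ (ii) ⇒ (iii); (b) if G_{C_p}-dim_{R_p}(M_p) < ∞ for all p ∈ X^{n-2}(R), then (i) and (ii) are equivalent; (c) if G_{C_p}-dim_{R_p}(M_p) < ∞ for all p ∈ X^{n-1}(R), then (i), (ii) and (iii) are all equivalent. -/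

import Mathlib

/- Preliminary definitions for formalizing
   "Linkage of modules with respect to a semidualizing module"
   (Dibaei–Sadeghi). -/

open CategoryTheory

universe u
noncomputable section
namespace Paper

variable (R : Type u) [CommRing R]

/-- `Ext^i_R(M,N)`, realized via Mathlib's derived-functor `Ext` for the
`R`-linear abelian category of `R`-modules. -/
abbrev ExtGrp (M N : Type u) [AddCommGroup M] [Module R M] [AddCommGroup N] [Module R N]
    (i : ℕ) : Type u :=
  ((Ext R (ModuleCat.{u} R) i).obj (Opposite.op (ModuleCat.of R M))).obj (ModuleCat.of R N)

/-- `Tor^R_i(M,N)`. -/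
abbrev TorGrp (M N : Type u) [AddCommGroup M] [Module R M] [AddCommGroup N] [Module R N]
    (i : ℕ) : Type u :=
  ((Tor (ModuleCat.{u} R) i).obj (ModuleCat.of R M)).obj (ModuleCat.of R N)

/-- Local cohomology `H^i_I(M)`. -/
abbrev LocCoh (I : Ideal R) (i : ℕ) (M : Type u) [AddCommGroup M] [Module R M] : Type u :=
  (localCohomology I i).obj (ModuleCat.of R M)

/-- A commutative ring is semiperfect iff it is a finite direct product of
commutative local rings. -/
def IsSemiperfectRing : Prop :=
  ∃ (n : ℕ) (A : Fin n → Type u) (c : ∀ i, CommRing (A i)),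
    (∀ i, letI := c i; IsLocalRing (A i)) ∧
    (letI := c; Nonempty (R ≃+* ((i : Fin n) → A i)))

/-- `C` is a semidualizing `R`-module: `C` is finitely generated, the homothety map
`R → Hom_R(C,C)` is bijective, and `Ext^i_R(C,C) = 0` for all `i > 0`. -/
def IsSemidualizing (C : Type u) [AddCommGroup C] [Module R C] : Prop :=
  Module.Finite R C ∧
  Function.Bijective (LinearMap.lsmul R C) ∧
  ∀ i : ℕ, 0 < i → Subsingleton (ExtGrp R C C i)

/-- A minimal projective presentation `P₁ → P₀ → M → 0` of `M`:
both `P₀ → M` and the induced `P₁ → ker(P₀ → M)` are projective covers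
(surjections from finitely generated projectives with superfluous kernels). -/
structure MinPres (M : Type u) [AddCommGroup M] [Module R M] where
  P₁ : Type u
  P₀ : Type u
  [acg₁ : AddCommGroup P₁]
  [acg₀ : AddCommGroup P₀]
  [mod₁ : Module R P₁]
  [mod₀ : Module R P₀]
  f : P₁ →ₗ[R] P₀
  g : P₀ →ₗ[R] M
  finite₁ : Module.Finite R P₁
  finite₀ : Module.Finite R P₀
  proj₁ : Module.Projective R P₁
  proj₀ : Module.Projective R P₀
  surj : Function.Surjective g
  exact : LinearMap.range f = LinearMap.ker g
  min₀ : ∀ N : Submodule R P₀, N ⊔ LinearMap.ker g = ⊤ → N = ⊤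
  min₁ : ∀ N : Submodule R P₁, N ⊔ LinearMap.ker f = ⊤ → N = ⊤

attribute [instance] MinPres.acg₁ MinPres.acg₀ MinPres.mod₁ MinPres.mod₀

variable {R}

/-- Given a minimal presentation `P₁ --f--> P₀ → X → 0` this is
`Hom(f,C) : Hom_R(P₀,C) → Hom_R(P₁,C)`; its image is `Ω_C Tr_C X` and its
cokernel is the transpose `Tr_C X` of `X` with respect to `C`. -/
def MinPres.homC {X : Type u} [AddCommGroup X] [Module R X]
    (C : Type u) [AddCommGroup C] [Module R C] (pres : MinPres R X) :
    (pres.P₀ →ₗ[R] C) →ₗ[R] (pres.P₁ →ₗ[R] C) :=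
  LinearMap.lcomp R C pres.f

/-- `Tr_C X` computed from a given minimal presentation. -/
def MinPres.trC {X : Type u} [AddCommGroup X] [Module R X]
    (C : Type u) [AddCommGroup C] [Module R C] (pres : MinPres R X) : Type u :=
  (pres.P₁ →ₗ[R] C) ⧸ LinearMap.range (pres.homC C)

instance {X : Type u} [AddCommGroup X] [Module R X] (C : Type u) [AddCommGroup C] [Module R C]
    (pres : MinPres R X) : AddCommGroup (pres.trC C) :=
  inferInstanceAs (AddCommGroup ((pres.P₁ →ₗ[R] C) ⧸ LinearMap.range (pres.homC C)))

instance {X : Type u} [AddCommGroup X] [Module R X] (C : Type u) [AddCommGroup C] [Module R C]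
    (pres : MinPres R X) : Module R (pres.trC C) :=
  inferInstanceAs (Module R ((pres.P₁ →ₗ[R] C) ⧸ LinearMap.range (pres.homC C)))

variable (R)

/-- `N ≅ Ω_C Tr_C X` : `N` is (isomorphic to) the image of `Hom(f,C)` for a
minimal projective presentation `P₁ --f--> P₀ → X → 0` of `X`. -/
def IsOmegaTrC (C : Type u) [AddCommGroup C] [Module R C]
    (X : Type u) [AddCommGroup X] [Module R X]
    (N : Type u) [AddCommGroup N] [Module R N] : Prop :=
  ∃ pres : MinPres R X, Nonempty (N ≃ₗ[R] ↥(LinearMap.range (pres.homC C)))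

/-- `N ≅ λ_R(C,M) = Ω_C Tr_C (Hom_R(C,M))`. -/
def IsLambdaOf (C : Type u) [AddCommGroup C] [Module R C]
    (M : Type u) [AddCommGroup M] [Module R M]
    (N : Type u) [AddCommGroup N] [Module R N] : Prop :=
  IsOmegaTrC R C (C →ₗ[R] M) N

/-- `M` is horizontally linked with respect to `C` : `M ≅ λ_R(C, λ_R(C,M))`. -/
def IsHorizontallyLinked (C : Type u) [AddCommGroup C] [Module R C]
    (M : Type u) [AddCommGroup M] [Module R M] : Prop :=
  ∃ N : ModuleCat.{u} R, IsLambdaOf R C M N ∧ IsLambdaOf R C N M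

/-- `M` is horizontally linked in the sense of Martsinkovsky–Strooker:
`M ≅ λ(λ M)` where `λ = Ω Tr`. -/
def IsHorizontallyLinkedMS (M : Type u) [AddCommGroup M] [Module R M] : Prop :=
  ∃ N : ModuleCat.{u} R, IsOmegaTrC R R M N ∧ IsOmegaTrC R R N M

/-- `underline-Hom_R(M,N) = 0` : every homomorphism `M → N` factors through a
projective module. -/
def StableHomZero (M N : Type u) [AddCommGroup M] [Module R M]
    [AddCommGroup N] [Module R N] : Prop :=
  ∀ φ : M →ₗ[R] N, ∃ P : ModuleCat.{u} R, Module.Projective R P ∧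
    ∃ (α : M →ₗ[R] P) (β : (P : Type u) →ₗ[R] N), β ∘ₗ α = φ

/-- `M` is `C`-stable: `M` has no nonzero direct summand of the form `P ⊗_R C`
with `P` projective. -/
def IsCStable (C M : Type u) [AddCommGroup C] [Module R C]
    [AddCommGroup M] [Module R M] : Prop :=
  ∀ N₁ N₂ : Submodule R M, IsCompl N₁ N₂ →
    ∀ P : ModuleCat.{u} R, Module.Projective R P →
      Nonempty (↥N₁ ≃ₗ[R] TensorProduct R P C) → N₁ = ⊥

/-- `M` is a `C`-syzygy: `M` embeds into a module `P ⊗_R C` with `P` projective. -/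
def IsCSyzygy (C M : Type u) [AddCommGroup C] [Module R C]
    [AddCommGroup M] [Module R M] : Prop :=
  ∃ P : ModuleCat.{u} R, Module.Projective R P ∧
    ∃ ι : M →ₗ[R] TensorProduct R (P : Type u) C, Function.Injective ι

/-- Auxiliary recursion for `n`-th `C`-syzygies. -/
def IsNthCSyzygyAux (C : Type u) [AddCommGroup C] [Module R C] :
    ℕ → ModuleCat.{u} R → Prop
  | 0, _ => True
  | (m+1), M =>
    ∃ P : ModuleCat.{u} R, Module.Projective R P ∧
      ∃ ι : (M : Type u) →ₗ[R] TensorProduct R (P : Type u) C, Function.Injective ι ∧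
        IsNthCSyzygyAux C m
          (ModuleCat.of R (TensorProduct R (P : Type u) C ⧸ LinearMap.range ι))

/-- `M` is an `n`-th `C`-syzygy: there is an exact sequence
`0 → M → C₁ → ⋯ → C_n` with each `C_j` of the form `P_j ⊗_R C`, `P_j` projective. -/
def IsNthCSyzygy (n : ℕ) (C M : Type u) [AddCommGroup C] [Module R C]
    [AddCommGroup M] [Module R M] : Prop :=
  IsNthCSyzygyAux R C n (ModuleCat.of R M)

/-- The biduality map `M → Hom_R(Hom_R(M,C),C)`. -/
def bidualityMap (C M : Type u) [AddCommGroup C] [Module R C]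
    [AddCommGroup M] [Module R M] : M →ₗ[R] ((M →ₗ[R] C) →ₗ[R] C) :=
  (LinearMap.id : (M →ₗ[R] C) →ₗ[R] (M →ₗ[R] C)).flip

/-- `M` has `G_C`-dimension zero. -/
def GCdimZero (C M : Type u) [AddCommGroup C] [Module R C]
    [AddCommGroup M] [Module R M] : Prop :=
  Module.Finite R M ∧
  Function.Bijective (bidualityMap R C M) ∧
  (∀ i : ℕ, 0 < i → Subsingleton (ExtGrp R M C i)) ∧
  (∀ i : ℕ, 0 < i → Subsingleton (ExtGrp R (M →ₗ[R] C) C i))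

/-- `G_C`-dim`_R(M) ≤ n`: there is a resolution of `M` of length `≤ n` by modules of
`G_C`-dimension zero. -/
def GCdimLE (C M : Type u) [AddCommGroup C] [Module R C]
    [AddCommGroup M] [Module R M] (n : ℕ) : Prop :=
  ∃ (G : ℕ → ModuleCat.{u} R) (d : ∀ i : ℕ, (G (i+1) : Type u) →ₗ[R] G i)
    (ε : (G 0 : Type u) →ₗ[R] M),
    Function.Surjective ε ∧
    LinearMap.range (d 0) = LinearMap.ker ε ∧
    (∀ i : ℕ, LinearMap.range (d (i+1)) = LinearMap.ker (d i)) ∧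
    (∀ i : ℕ, GCdimZero R C (G i)) ∧
    (∀ i : ℕ, n < i → Subsingleton (G i))

/-- `G_C`-dim`_R(M) < ∞`. -/
def GCdimFinite (C M : Type u) [AddCommGroup C] [Module R C]
    [AddCommGroup M] [Module R M] : Prop :=
  ∃ n : ℕ, GCdimLE R C M n

/-- The "depth of `I` on `M`" (classical grade): `inf{ i | Ext^i_R(R/I, M) ≠ 0 }`,
as an extended natural number. -/
def edepth (I : Ideal R) (M : Type u) [AddCommGroup M] [Module R M] : ℕ∞ :=
  sInf {n : ℕ∞ | ∃ i : ℕ, n = i ∧ Nontrivial (ExtGrp R (R ⧸ I) M i)}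

/-- The depth of a module over a local ring. -/
def ldepth [IsLocalRing R] (M : Type u) [AddCommGroup M] [Module R M] : ℕ∞ :=
  edepth R (IsLocalRing.maximalIdeal R) M

/-- `depth_{R_p}(M_p)`. -/
def depthAt (p : Ideal R) [p.IsPrime] (M : Type u) [AddCommGroup M] [Module R M] : ℕ∞ :=
  ldepth (Localization.AtPrime p) (LocalizedModule p.primeCompl M)

/-- `depth R_p`. -/
def ringDepthAt (p : Ideal R) [p.IsPrime] : ℕ∞ :=
  ldepth (Localization.AtPrime p) (Localization.AtPrime p)

/-- Serre's condition `(S̃_n)`: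
`depth_{R_p}(M_p) ≥ min{n, depth R_p}` for all primes `p`. -/
def SerreTilde (n : ℕ) (M : Type u) [AddCommGroup M] [Module R M] : Prop :=
  ∀ (p : Ideal R) (_ : p.IsPrime), min (n : ℕ∞) (ringDepthAt R p) ≤ depthAt R p M

/-- Serre's condition `(S_n)`:
`depth_{R_p}(M_p) ≥ min{n, dim R_p}` for all primes `p`. -/
def SerreS (n : ℕ) (M : Type u) [AddCommGroup M] [Module R M] : Prop :=
  ∀ (p : Ideal R) (_ : p.IsPrime),
    min (n : WithBot ℕ∞) (ringKrullDim (Localization.AtPrime p)) ≤ (depthAt R p M : WithBot ℕ∞)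

/-- The dimension of a module: `dim_R(M) = dim (R / ann_R M)`. -/
def moduleDim (M : Type u) [AddCommGroup M] [Module R M] : WithBot ℕ∞ :=
  ringKrullDim (R ⧸ Module.annihilator R M)

/-- A Cohen-Macaulay module over a local ring: `depth_R(M) = dim_R(M)`. -/
def IsCMModule [IsLocalRing R] (M : Type u) [AddCommGroup M] [Module R M] : Prop :=
  (ldepth R M : WithBot ℕ∞) = moduleDim R M

/-- A maximal Cohen-Macaulay module over a local ring: `depth_R(M) = dim R`. -/
def IsMaximalCM [IsLocalRing R] (M : Type u) [AddCommGroup M] [Module R M] : Prop :=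
  (ldepth R M : WithBot ℕ∞) = ringKrullDim R

/-- A Cohen-Macaulay local ring. -/
def IsCMLocalRing : Prop :=
  ∃ _ : IsLocalRing R, (ldepth R R : WithBot ℕ∞) = ringKrullDim R

/-- `C` has finite injective dimension: for some `n`, `Ext^i_R(-,C)` vanishes
for all `i > n`. -/
def HasFiniteInjDim (C : Type u) [AddCommGroup C] [Module R C] : Prop :=
  ∃ n : ℕ, ∀ (M : ModuleCat.{u} R) (i : ℕ), n < i →
    Subsingleton (((Ext R (ModuleCat.{u} R) i).obj (Opposite.op M)).obj (ModuleCat.of R C))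

/-- `ω` is a canonical module of `R`: a semidualizing module of finite injective
dimension. -/
def IsCanonicalModule (ω : Type u) [AddCommGroup ω] [Module R ω] : Prop :=
  IsSemidualizing R ω ∧ HasFiniteInjDim R ω

/-- `Gid_R(M) ≤ n`: there is an exact complex `⋯ → I_1 → I_0 → I_{-1} → ⋯` of
injective modules, which stays exact under `Hom_R(E,-)` for every injective `E`,
with `M ≅ ker(I_0 → I_{-1})` and `I_j = 0` for `j < -n`. -/
def GidLE (M : Type u) [AddCommGroup M] [Module R M] (n : ℕ) : Prop :=
  ∃ (I : ℤ → ModuleCat.{u} R) (d : ∀ i : ℤ, (I (i+1) : Type u) →ₗ[R] I i),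
    (∀ i : ℤ, Module.Injective R (I i)) ∧
    (∀ i : ℤ, LinearMap.range (d (i+1)) = LinearMap.ker (d i)) ∧
    (∀ E : ModuleCat.{u} R, Module.Injective R E →
      ∀ (i : ℤ) (φ : (E : Type u) →ₗ[R] I (i+1)), d i ∘ₗ φ = 0 →
        ∃ ψ : (E : Type u) →ₗ[R] I (i+1+1), d (i+1) ∘ₗ ψ = φ) ∧
    Nonempty (M ≃ₗ[R] ↥(LinearMap.ker (d (-1)))) ∧
    (∀ i : ℤ, i < -(n : ℤ) → Subsingleton (I i))

/-- `M` has finite Gorenstein injective dimension. -/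
def HasFiniteGid (M : Type u) [AddCommGroup M] [Module R M] : Prop :=
  ∃ n : ℕ, GidLE R M n

/-- The evaluation map `C ⊗_R Hom_R(C,M) → M`. -/
def evalMap (C M : Type u) [AddCommGroup C] [Module R C]
    [AddCommGroup M] [Module R M] : TensorProduct R C (C →ₗ[R] M) →ₗ[R] M :=
  TensorProduct.lift ((LinearMap.id : (C →ₗ[R] M) →ₗ[R] (C →ₗ[R] M)).flip)

/-- Membership in the Bass class `B_C`. -/
def MemBass (C M : Type u) [AddCommGroup C] [Module R C]
    [AddCommGroup M] [Module R M] : Prop :=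
  Function.Bijective (evalMap R C M) ∧
  (∀ i : ℕ, 0 < i → Subsingleton (TorGrp R (C →ₗ[R] M) C i)) ∧
  (∀ i : ℕ, 0 < i → Subsingleton (ExtGrp R C M i))

/-- Membership in the Auslander class `A_C`. -/
def MemAus (C M : Type u) [AddCommGroup C] [Module R C]
    [AddCommGroup M] [Module R M] : Prop :=
  Function.Bijective (TensorProduct.mk R M C) ∧
  (∀ i : ℕ, 0 < i → Subsingleton (TorGrp R M C i)) ∧
  (∀ i : ℕ, 0 < i → Subsingleton (ExtGrp R C (TensorProduct R M C) i))

/-- The grade of a module: the common length of maximal `R`-regular sequences in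
`ann_R(M)`, i.e. `inf{ i | Ext^i(R/ann M, R) ≠ 0 }`. -/
def gradeMod (M : Type u) [AddCommGroup M] [Module R M] : ℕ∞ :=
  edepth R (Module.annihilator R M) R

/-- The grade of an ideal `I`, i.e. `grade_R(R/I)`. -/
def gradeIdeal (I : Ideal R) : ℕ∞ :=
  edepth R I R

/-- An unmixed ideal: every associated prime of `R/I` is a minimal prime of `I`. -/
def IsUnmixedIdeal (I : Ideal R) : Prop :=
  ∀ p ∈ associatedPrimes R (R ⧸ I), p ∈ I.minimalPrimes

/-- Equality of the `a`-th Bass number of `R` (over `R`, w.r.t. the maximal ideal `m`)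
and the `b`-th Bass number of `A` (over `A`, w.r.t. the maximal ideal `mA`): both Ext
modules are vector spaces over the corresponding residue fields of one and the same
dimension. -/
def BassNumbersEq (m : Ideal R) (a : ℕ) (A : Type u) [CommRing A] (mA : Ideal A) (b : ℕ) : Prop :=
  ∃ ι : Type u,
    Nonempty (ExtGrp R (R ⧸ m) R a ≃ₗ[R] (ι →₀ (R ⧸ m))) ∧
    Nonempty (ExtGrp A (A ⧸ mA) A b ≃ₗ[A] (ι →₀ (A ⧸ mA)))

/-- A quasi-Gorenstein ideal of a local ring `R`: `G-dim_R(R/a) < ∞` and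
`μ^{i+depth R}_R(R) = μ^{i+depth R/a}_{R/a}(R/a)` for all `i ≥ 0`. -/
def IsQuasiGorensteinIdeal [IsLocalRing R] (a : Ideal R) : Prop :=
  GCdimFinite R R (R ⧸ a) ∧
  ∀ i : ℕ,
    BassNumbersEq R (IsLocalRing.maximalIdeal R) (i + (ldepth R R).toNat)
      (R ⧸ a) (Ideal.map (Ideal.Quotient.mk a) (IsLocalRing.maximalIdeal R))
      (i + (edepth (R ⧸ a) (Ideal.map (Ideal.Quotient.mk a) (IsLocalRing.maximalIdeal R))
        (R ⧸ a)).toNat)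

/-- `E` is an injective hull of `K`: `E` is injective and contains a copy of `K`
as an essential submodule. -/
def IsInjectiveHull (K E : Type u) [AddCommGroup K] [Module R K]
    [AddCommGroup E] [Module R E] : Prop :=
  Module.Injective R E ∧
  ∃ ι : K →ₗ[R] E, Function.Injective ι ∧
    ∀ N : Submodule R E, N ≠ ⊥ → N ⊓ LinearMap.range ι ≠ ⊥

/-- A generalized Cohen-Macaulay module over a local ring: `dim M ≥ 1` and
`H^i_m(M)` has finite length for all `i < dim M`. -/
def IsGeneralizedCM [IsLocalRing R] (M : Type u) [AddCommGroup M] [Module R M] : Prop :=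
  1 ≤ moduleDim R M ∧
  ∀ i : ℕ, (i : WithBot ℕ∞) < moduleDim R M →
    IsFiniteLength R (LocCoh R (IsLocalRing.maximalIdeal R) i M)

end Paper

namespace Linkage

section

variable {R : Type u} [CommRing R]

/-- `Ext^i_R(M,N)` as morphisms in the derived category. -/
abbrev DExt (R : Type u) [CommRing R] (M N : Type u) [AddCommGroup M] [Module R M]
    [AddCommGroup N] [Module R N] (i : ℕ) : Type u :=
  Abelian.Ext (ModuleCat.of R M) (ModuleCat.of R N) i

/-- The vanishing of `Ext^i_R(M,N)`. -/
def ExtVanish (R : Type u) [CommRing R] (M N : Type u) [AddCommGroup M] [Module R M]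
    [AddCommGroup N] [Module R N] (i : ℕ) : Prop :=
  Subsingleton (DExt R M N i)

section bridge

variable {X : ModuleCat.{u} R} (P : ProjectiveResolution X) (Y : ModuleCat.{u} R)

lemma subsingleton_ext_succ_iff (i : ℕ) :
    Subsingleton (Abelian.Ext X Y (i + 1)) ↔
      ∀ f : P.complex.X (i + 1) ⟶ Y, P.complex.d (i + 2) (i + 1) ≫ f = 0 →
        ∃ g : P.complex.X i ⟶ Y, P.complex.d (i + 1) i ≫ g = f := by
  constructor
  · intro h f hf
    exact (P.extMk_eq_zero_iff f (i + 2) rfl hf i rfl).1 (Subsingleton.elim _ _)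
  · intro h
    refine ⟨fun a b => ?_⟩
    suffices ∀ a : Abelian.Ext X Y (i + 1), a = 0 by rw [this a, this b]
    intro a
    obtain ⟨f, hf, rfl⟩ := P.extMk_surjective a (i + 2) rfl
    exact (P.extMk_eq_zero_iff f (i + 2) rfl hf i rfl).2 (h f hf)

lemma subsingleton_derived_ext_succ_iff (i : ℕ) :
    Subsingleton (((Ext R (ModuleCat.{u} R) (i + 1)).obj (Opposite.op X)).obj Y) ↔
      ∀ f : P.complex.X (i + 1) ⟶ Y, P.complex.d (i + 2) (i + 1) ≫ f = 0 →
        ∃ g : P.complex.X i ⟶ Y, P.complex.d (i + 1) i ≫ g = f := by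
  rw [← ModuleCat.isZero_iff_subsingleton, (P.isoExt (i + 1) Y).isZero_iff,
    ← HomologicalComplex.exactAt_iff_isZero_homology,
    HomologicalComplex.exactAt_iff' _ i (i + 1) (i + 2) (by simp) (by simp),
    ShortComplex.ShortExact.moduleCat_exact_iff_function_exact]
  refine ⟨fun h f hf => (h f).1 hf, fun h f => ⟨fun hf => h f hf, ?_⟩⟩
  rintro ⟨g, rfl⟩
  have h0 : ∀ g : P.complex.X i ⟶ Y,
      P.complex.d (i + 2) (i + 1) ≫ P.complex.d (i + 1) i ≫ g = 0 := by simp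
  exact h0 g

lemma subsingleton_derived_ext_zero_iff :
    Subsingleton (((Ext R (ModuleCat.{u} R) 0).obj (Opposite.op X)).obj Y) ↔
      ∀ f : X ⟶ Y, f = 0 := by
  let P := projectiveResolution X
  rw [← ModuleCat.isZero_iff_subsingleton, (P.isoExt 0 Y).isZero_iff,
    ← HomologicalComplex.exactAt_iff_isZero_homology,
    HomologicalComplex.exactAt_iff' _ 0 0 1 (by simp) (by simp),
    ShortComplex.ShortExact.moduleCat_exact_iff_function_exact]
  have h0 : ∀ g : P.complex.X 0 ⟶ Y, P.complex.d 0 0 ≫ g = 0 := fun g => by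
    rw [P.complex.shape 0 0 (by simp), Limits.zero_comp]
  have h1 : (∀ g : P.complex.X 0 ⟶ Y, P.complex.d 1 0 ≫ g = 0 → g = 0) ↔
      ∀ f : X ⟶ Y, f = 0 := by
    let π : P.complex.X 0 ⟶ X := P.π.f 0
    have hπ : Epi π := inferInstanceAs (Epi (P.π.f 0))
    have hdπ : P.complex.d 1 0 ≫ π = 0 := P.complex_d_comp_π_f_zero
    constructor
    · intro h f
      rw [← cancel_epi π, Limits.comp_zero]
      exact h _ (by rw [← Category.assoc, hdπ, Limits.zero_comp])
    · intro h g hg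
      obtain ⟨f, rfl⟩ : ∃ f : X ⟶ Y, π ≫ f = g :=
        ⟨P.exact₀.desc g hg, P.exact₀.g_desc g hg⟩
      rw [h f, Limits.comp_zero]
  rw [← h1]
  constructor
  · intro h g hg
    obtain ⟨g', hg'⟩ := (h g).1 hg
    exact hg'.symm.trans (h0 g')
  · intro h g
    refine ⟨fun hg => ⟨0, ?_⟩, ?_⟩
    · rw [map_zero]; exact (h g hg).symm
    · rintro ⟨g', rfl⟩
      have h2 : ∀ g : P.complex.X 0 ⟶ Y, P.complex.d 1 0 ≫ P.complex.d 0 0 ≫ g = 0 := by simp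
      exact h2 g'
end bridge

lemma extGrp_iff (M N : Type u) [AddCommGroup M] [Module R M]
    [AddCommGroup N] [Module R N] (i : ℕ) :
    Subsingleton (Paper.ExtGrp R M N i) ↔ ExtVanish R M N i := by
  let P := projectiveResolution (ModuleCat.of R M)
  cases i with
  | succ i =>
    rw [Paper.ExtGrp, subsingleton_derived_ext_succ_iff P, ExtVanish, subsingleton_ext_succ_iff P]
  | zero =>
    rw [Paper.ExtGrp, subsingleton_derived_ext_zero_iff, ExtVanish,
      Abelian.Ext.homEquiv₀.subsingleton_congr]
    exact ⟨fun h => ⟨fun a b => by rw [h a, h b]⟩, fun h f => Subsingleton.elim _ _⟩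

end

section

variable {R : Type u} [CommRing R]
variable {A B D X Y Z : Type u} [AddCommGroup A] [AddCommGroup B] [AddCommGroup D]
  [AddCommGroup X] [AddCommGroup Y] [AddCommGroup Z]
  [Module R A] [Module R B] [Module R D] [Module R X] [Module R Y] [Module R Z]

/-- `0 → A → B → D → 0` is exact. -/
structure IsSES (f : A →ₗ[R] B) (g : B →ₗ[R] D) : Prop where
  inj : Function.Injective f
  exact : Function.Exact f g
  surj : Function.Surjective g

namespace IsSES

variable {f : A →ₗ[R] B} {g : B →ₗ[R] D}

lemma comp_eq_zero (h : IsSES f g) : g ∘ₗ f = 0 := h.exact.linearMap_comp_eq_zero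

lemma apply_apply (h : IsSES f g) (a : A) : g (f a) = 0 := h.exact.apply_apply_eq_zero a

/-- The associated short complex. -/
abbrev cx (h : IsSES f g) : ShortComplex (ModuleCat.{u} R) :=
  ModuleCat.shortComplexOfCompEqZero f g h.comp_eq_zero

lemma shortExact (h : IsSES f g) : h.cx.ShortExact :=
  ModuleCat.shortComplex_shortExact _ h.exact h.inj h.surj

lemma mkQ (p : Submodule R A) : IsSES p.subtype p.mkQ :=
  ⟨p.injective_subtype, LinearMap.exact_subtype_mkQ p, p.mkQ_surjective⟩

lemma rangeMkQ (hf : Function.Injective f) : IsSES f (LinearMap.range f).mkQ :=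
  ⟨hf, LinearMap.exact_map_mkQ_range f, Submodule.mkQ_surjective _⟩

lemma kerSubtype (hg : Function.Surjective g) : IsSES (LinearMap.ker g).subtype g :=
  ⟨Submodule.injective_subtype _, LinearMap.exact_subtype_ker_map g, hg⟩

end IsSES

/-- Covariant functoriality of `Ext`. -/
def push (X : Type u) [AddCommGroup X] [Module R X] (f : A →ₗ[R] B) (i : ℕ) :
    DExt R X A i → DExt R X B i :=
  fun e => e.comp (Abelian.Ext.mk₀ (ModuleCat.ofHom f)) (add_zero i)

lemma push_comp (f : A →ₗ[R] B) (g : B →ₗ[R] D) (i : ℕ) (e : DExt R X A i) :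
    push X (g ∘ₗ f) i e = push X g i (push X f i e) := by
  simp [push]

lemma push_id (i : ℕ) (e : DExt R X A i) : push X (LinearMap.id : A →ₗ[R] A) i e = e := by
  simp [push]

lemma push_zero_map (i : ℕ) (e : DExt R X A i) : push X (0 : A →ₗ[R] B) i e = 0 := by
  simp [push]

lemma push_add_map (f f' : A →ₗ[R] B) (i : ℕ) (e : DExt R X A i) :
    push X (f + f') i e = push X f i e + push X f' i e := by
  simp [push, Abelian.Ext.mk₀_add]

lemma push_sum_map {ι : Type*} (s : Finset ι) (f : ι → A →ₗ[R] B) (i : ℕ) (e : DExt R X A i) :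
    push X (∑ j ∈ s, f j) i e = ∑ j ∈ s, push X (f j) i e := by
  classical
  induction s using Finset.induction with
  | empty => simp [push_zero_map]
  | insert a s ha ih => simp [Finset.sum_insert ha, push_add_map, ih]

lemma push_smul_map (r : R) (f : A →ₗ[R] B) (i : ℕ) (e : DExt R X A i) :
    push X (r • f) i e = r • push X f i e := by
  have h : ModuleCat.ofHom (r • f) = r • ModuleCat.ofHom f := rfl
  simp [push, h, Abelian.Ext.mk₀_smul]

lemma push_zero (f : A →ₗ[R] B) (i : ℕ) : push X f i 0 = 0 := by
  simp [push]

lemma push_sub (f : A →ₗ[R] B) (i : ℕ) (e e' : DExt R X A i) :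
    push X f i (e - e') = push X f i e - push X f i e' := by
  simp [push, sub_eq_add_neg]

lemma smul_ext_eq_zero (r : R) (hr : ∀ x : X, r • x = 0) (i : ℕ) (e : DExt R X A i) :
    r • e = 0 := by
  have h : r • (𝟙 (ModuleCat.of R X)) = 0 := by
    ext x
    exact hr x
  rw [← Abelian.Ext.mk₀_id_comp e, ← Abelian.Ext.smul_comp, ← Abelian.Ext.mk₀_smul, h]
  simp

lemma ExtVanish.eq_zero {i : ℕ} (h : ExtVanish R X Y i) (e : DExt R X Y i) : e = 0 :=
  have : Subsingleton (DExt R X Y i) := h; Subsingleton.elim e 0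

lemma extVanish_iff {i : ℕ} : ExtVanish R X Y i ↔ ∀ e : DExt R X Y i, e = 0 :=
  ⟨fun h e => h.eq_zero e, fun h => ⟨fun a b => by rw [h a, h b]⟩⟩

namespace IsSES

variable {f : A →ₗ[R] B} {g : B →ₗ[R] D}

lemma exists_push_eq (h : IsSES f g) {i : ℕ} (e : DExt R X B i) (he : push X g i e = 0) :
    ∃ a : DExt R X A i, push X f i a = e :=
  Abelian.Ext.covariant_sequence_exact₂ _ h.shortExact e he

lemma push_injective (h : IsSES f g) {i : ℕ} (hD : ∀ j, j + 1 = i → ExtVanish R X D j) :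
    Function.Injective (push X f i) := by
  suffices ∀ e, push X f i e = 0 → e = 0 by
    intro a b hab
    rw [← sub_eq_zero]
    apply this
    rw [push_sub, hab, sub_self]
  intro e he
  cases i with
  | zero =>
    obtain ⟨φ, rfl⟩ := Abelian.Ext.homEquiv₀.symm.surjective e
    have : Mono (ModuleCat.ofHom f) := (ModuleCat.mono_iff_injective _).2 h.inj
    simp only [push, Abelian.Ext.homEquiv₀_symm_apply, Abelian.Ext.mk₀_comp_mk₀,
      Abelian.Ext.mk₀_eq_zero_iff] at he ⊢
    rwa [← cancel_mono (ModuleCat.ofHom f), Limits.zero_comp]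
  | succ i =>
    obtain ⟨d, rfl⟩ := Abelian.Ext.covariant_sequence_exact₁ _ h.shortExact e he rfl
    rw [(hD i rfl).eq_zero d]
    simp

lemma cov_mid (h : IsSES f g) {i : ℕ} (hA : ExtVanish R X A i) (hD : ExtVanish R X D i) :
    ExtVanish R X B i := by
  rw [extVanish_iff]
  intro e
  obtain ⟨a, rfl⟩ := h.exists_push_eq e (hD.eq_zero _)
  rw [hA.eq_zero a, push_zero]

lemma cov_right (h : IsSES f g) {i : ℕ} (hB : ExtVanish R X B i)
    (hA : ExtVanish R X A (i + 1)) : ExtVanish R X D i := by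
  rw [extVanish_iff]
  intro e
  obtain ⟨b, rfl⟩ := Abelian.Ext.covariant_sequence_exact₃ _ h.shortExact e rfl (hA.eq_zero _)
  rw [hB.eq_zero b]
  simp

lemma cov_left (h : IsSES f g) {i : ℕ} (hD : ExtVanish R X D i)
    (hB : ExtVanish R X B (i + 1)) : ExtVanish R X A (i + 1) := by
  rw [extVanish_iff]
  intro e
  exact h.push_injective (i := i + 1) (fun j hj => by cases hj; exact hD)
    ((hB.eq_zero _).trans (push_zero _ _).symm)

lemma con_left (h : IsSES f g) {i : ℕ} (hB : ExtVanish R B Y i)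
    (hD : ExtVanish R D Y (i + 1)) : ExtVanish R A Y i := by
  rw [extVanish_iff]
  intro e
  obtain ⟨a, rfl⟩ := Abelian.Ext.contravariant_sequence_exact₁ h.shortExact _ e
    (add_comm 1 i) (hD.eq_zero _)
  rw [hB.eq_zero a]
  simp

lemma con_right (h : IsSES f g) {i : ℕ} (hA : ExtVanish R A Y i)
    (hB : ExtVanish R B Y (i + 1)) : ExtVanish R D Y (i + 1) := by
  rw [extVanish_iff]
  intro e
  obtain ⟨a, rfl⟩ := Abelian.Ext.contravariant_sequence_exact₃ h.shortExact _ e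
    (hB.eq_zero _) (add_comm 1 i)
  rw [hA.eq_zero a]
  simp

lemma exists_lift (h : IsSES f g) (hA : ExtVanish R X A 1) (φ : X →ₗ[R] D) :
    ∃ ψ : X →ₗ[R] B, g ∘ₗ ψ = φ := by
  obtain ⟨b, hb⟩ := Abelian.Ext.covariant_sequence_exact₃ (ModuleCat.of R X) h.shortExact
    (Abelian.Ext.mk₀ (ModuleCat.ofHom φ)) (zero_add 1) (hA.eq_zero _)
  obtain ⟨ψ, rfl⟩ := Abelian.Ext.homEquiv₀.symm.surjective b
  simp only [Abelian.Ext.homEquiv₀_symm_apply, Abelian.Ext.mk₀_comp_mk₀] at hb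
  have := Abelian.Ext.homEquiv₀.symm.injective hb
  exact ⟨ψ.hom, congrArg ModuleCat.Hom.hom this⟩

lemma exists_ext (h : IsSES f g) (hD : ExtVanish R D Y 1) (φ : A →ₗ[R] Y) :
    ∃ ψ : B →ₗ[R] Y, ψ ∘ₗ f = φ := by
  obtain ⟨b, hb⟩ := Abelian.Ext.contravariant_sequence_exact₁ h.shortExact (ModuleCat.of R Y)
    (Abelian.Ext.mk₀ (ModuleCat.ofHom φ)) (add_zero 1) (hD.eq_zero _)
  obtain ⟨ψ, rfl⟩ := Abelian.Ext.homEquiv₀.symm.surjective b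
  simp only [Abelian.Ext.homEquiv₀_symm_apply, Abelian.Ext.mk₀_comp_mk₀] at hb
  have := Abelian.Ext.homEquiv₀.symm.injective hb
  exact ⟨ψ.hom, congrArg ModuleCat.Hom.hom this⟩

lemma con_of_exists_ext (h : IsSES f g) (hB : ExtVanish R B Y 1)
    (hext : ∀ φ : A →ₗ[R] Y, ∃ ψ : B →ₗ[R] Y, ψ ∘ₗ f = φ) : ExtVanish R D Y 1 := by
  rw [extVanish_iff]
  intro e
  obtain ⟨a, rfl⟩ := Abelian.Ext.contravariant_sequence_exact₃ h.shortExact _ e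
    (hB.eq_zero _) (add_zero 1)
  obtain ⟨φ, rfl⟩ := Abelian.Ext.homEquiv₀.symm.surjective a
  obtain ⟨ψ, hψ⟩ := hext φ.hom
  have : φ = h.cx.f ≫ ModuleCat.ofHom ψ := by
    ext x; exact (LinearMap.congr_fun hψ x).symm
  subst this
  simp only [Abelian.Ext.homEquiv₀_symm_apply]
  rw [← Abelian.Ext.mk₀_comp_mk₀, h.shortExact.extClass_comp_assoc]

lemma cov_of_exists_lift (h : IsSES f g) (hB : ExtVanish R X B 1)
    (hlift : ∀ φ : X →ₗ[R] D, ∃ ψ : X →ₗ[R] B, g ∘ₗ ψ = φ) : ExtVanish R X A 1 := by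
  rw [extVanish_iff]
  intro e
  obtain ⟨a, rfl⟩ := Abelian.Ext.covariant_sequence_exact₁ _ h.shortExact e
    (hB.eq_zero _) (zero_add 1)
  obtain ⟨φ, rfl⟩ := Abelian.Ext.homEquiv₀.symm.surjective a
  obtain ⟨ψ, hψ⟩ := hlift φ.hom
  have : φ = ModuleCat.ofHom ψ ≫ h.cx.g := by
    ext x; exact (LinearMap.congr_fun hψ x).symm
  subst this
  simp only [Abelian.Ext.homEquiv₀_symm_apply]
  rw [← Abelian.Ext.mk₀_comp_mk₀, Abelian.Ext.comp_assoc _ _ _ (zero_add 0) (zero_add 1) (by simp),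
    h.shortExact.comp_extClass, Abelian.Ext.comp_zero]

end IsSES

lemma extVanish_zero_iff : ExtVanish R X Y 0 ↔ ∀ φ : X →ₗ[R] Y, φ = 0 := by
  rw [ExtVanish, Abelian.Ext.homEquiv₀.subsingleton_congr]
  constructor
  · intro h φ
    exact congrArg ModuleCat.Hom.hom (Subsingleton.elim (ModuleCat.ofHom φ) 0)
  · intro h
    refine ⟨fun a b => ?_⟩
    ext x
    rw [h a.hom, h b.hom]

lemma extVanish_of_projective [Module.Projective R X] (i : ℕ) : ExtVanish R X Y (i + 1) := by
  have : Projective (ModuleCat.of R X) := (IsProjective.iff_projective X).1 ‹_›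
  exact extVanish_iff.2 fun e => Abelian.Ext.eq_zero_of_projective e

lemma ExtVanish.retract_right {i : ℕ} (h : ExtVanish R X B i) (s : A →ₗ[R] B) (r : B →ₗ[R] A)
    (hrs : r ∘ₗ s = LinearMap.id) : ExtVanish R X A i := by
  rw [extVanish_iff]
  intro e
  rw [← push_id i e, ← hrs, push_comp, h.eq_zero (push X s i e), push_zero]

lemma ExtVanish.retract_left {i : ℕ} (h : ExtVanish R B Y i) (s : A →ₗ[R] B) (r : B →ₗ[R] A)
    (hrs : r ∘ₗ s = LinearMap.id) : ExtVanish R A Y i := by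
  rw [extVanish_iff]
  intro e
  have h1 : ModuleCat.ofHom s ≫ ModuleCat.ofHom r = 𝟙 (ModuleCat.of R A) := by
    rw [← ModuleCat.ofHom_comp, hrs]; rfl
  rw [← Abelian.Ext.mk₀_id_comp e, ← h1, ← Abelian.Ext.mk₀_comp_mk₀_assoc,
    h.eq_zero ((Abelian.Ext.mk₀ (ModuleCat.ofHom r)).comp e (zero_add i)), Abelian.Ext.comp_zero]

lemma ExtVanish.congr_right {i : ℕ} (e : A ≃ₗ[R] B) (h : ExtVanish R X A i) :
    ExtVanish R X B i :=
  h.retract_right e.symm.toLinearMap e.toLinearMap (by ext; simp)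

lemma ExtVanish.congr_left {i : ℕ} (e : A ≃ₗ[R] B) (h : ExtVanish R A Y i) :
    ExtVanish R B Y i :=
  h.retract_left e.symm.toLinearMap e.toLinearMap (by ext; simp)

lemma IsSES.prod (R A B : Type u) [CommRing R] [AddCommGroup A] [AddCommGroup B] [Module R A]
    [Module R B] : IsSES (LinearMap.inl R A B) (LinearMap.snd R A B) :=
  ⟨LinearMap.inl_injective, .inl_snd, LinearMap.snd_surjective⟩

lemma extVanish_of_subsingleton_right [Subsingleton Y] (i : ℕ) : ExtVanish R X Y i := by
  rw [extVanish_iff]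
  intro e
  have : (LinearMap.id : Y →ₗ[R] Y) = 0 := Subsingleton.elim _ _
  rw [← push_id i e, this, push_zero_map]

lemma extVanish_of_subsingleton_left [Subsingleton X] (i : ℕ) : ExtVanish R X Y i := by
  cases i with
  | zero =>
    rw [extVanish_zero_iff]
    exact fun φ => Subsingleton.elim _ _
  | succ i => exact extVanish_of_projective i

lemma ExtVanish.finFun {i : ℕ} (h : ExtVanish R X Y i) (b : ℕ) :
    ExtVanish R X (Fin b → Y) i := by
  induction b with
  | zero => exact extVanish_of_subsingleton_right i
  | succ b ih =>
    exact ((IsSES.prod R Y (Fin b → Y)).cov_mid h ih).congr_right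
      (Fin.consLinearEquiv R (fun _ => Y))

end

section

variable {R : Type u} [CommRing R]
variable {A B D X Y Z C : Type u} [AddCommGroup A] [AddCommGroup B] [AddCommGroup D]
  [AddCommGroup X] [AddCommGroup Y] [AddCommGroup Z] [AddCommGroup C]
  [Module R A] [Module R B] [Module R D] [Module R X] [Module R Y] [Module R Z] [Module R C]

namespace IsSES

variable {f : A →ₗ[R] B} {g : B →ₗ[R] D}

lemma lcomp_injective (h : IsSES f g) : Function.Injective (LinearMap.lcomp R Y g) := by
  intro a b hab
  ext x
  obtain ⟨y, rfl⟩ := h.surj x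
  exact LinearMap.congr_fun hab y

lemma lcomp_exact (h : IsSES f g) :
    Function.Exact (LinearMap.lcomp R Y g) (LinearMap.lcomp R Y f) := by
  intro φ
  constructor
  · intro hφ
    have hk : LinearMap.ker g ≤ LinearMap.ker φ := by
      intro b hb
      obtain ⟨a, rfl⟩ := (h.exact b).1 hb
      exact LinearMap.congr_fun hφ a
    refine ⟨(LinearMap.ker g).liftQ φ hk ∘ₗ (g.quotKerEquivOfSurjective h.surj).symm.toLinearMap,
      ?_⟩
    ext b
    have : (g.quotKerEquivOfSurjective h.surj).symm (g b) = Submodule.Quotient.mk b := by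
      rw [LinearEquiv.symm_apply_eq]; rfl
    simp [this]
  · rintro ⟨φ, rfl⟩
    ext a
    simp [h.apply_apply]

lemma dual_of_surjective (h : IsSES f g) (hs : Function.Surjective (LinearMap.lcomp R Y f)) :
    IsSES (LinearMap.lcomp R Y g) (LinearMap.lcomp R Y f) :=
  ⟨h.lcomp_injective, h.lcomp_exact, hs⟩

lemma dual (h : IsSES f g) (hD : ExtVanish R D Y 1) :
    IsSES (LinearMap.lcomp R Y g) (LinearMap.lcomp R Y f) :=
  h.dual_of_surjective fun φ => h.exists_ext hD φ

lemma dual_rangeRestrict (h : IsSES f g) :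
    IsSES (LinearMap.lcomp R Y g) (LinearMap.lcomp R Y f).rangeRestrict := by
  refine ⟨h.lcomp_injective, ?_, LinearMap.surjective_rangeRestrict _⟩
  intro φ
  rw [← h.lcomp_exact φ, ← Subtype.coe_inj]
  rfl

end IsSES

/-- A finitely generated projective module is a retract of a finite free module. -/
lemma exists_retract_finFun (R Q : Type u) [CommRing R] [AddCommGroup Q] [Module R Q]
    [Module.Finite R Q] [Module.Projective R Q] :
    ∃ (b : ℕ) (s : Q →ₗ[R] (Fin b → R)) (r : (Fin b → R) →ₗ[R] Q), r ∘ₗ s = LinearMap.id := by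
  obtain ⟨b, r, hr⟩ := Module.Finite.exists_fin' R Q
  obtain ⟨s, hs⟩ := Module.projective_lifting_property r LinearMap.id hr
  exact ⟨b, s, r, hs⟩

lemma ExtVanish.homProjective {i : ℕ} (h : ExtVanish R X C i) (Q : Type u) [AddCommGroup Q]
    [Module R Q] [Module.Finite R Q] [Module.Projective R Q] :
    ExtVanish R X (Q →ₗ[R] C) i := by
  obtain ⟨b, s, r, hrs⟩ := exists_retract_finFun R Q
  refine ((h.finFun b).congr_right (LinearEquiv.piRing R C (Fin b) R).symm).retract_right
    (LinearMap.lcomp R C r) (LinearMap.lcomp R C s) ?_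
  ext φ x
  exact congrArg φ (LinearMap.congr_fun hrs x)

/-- A module whose elements are separated by homomorphisms to `C`. -/
def Torsionless (R C X : Type u) [CommRing R] [AddCommGroup C] [Module R C]
    [AddCommGroup X] [Module R X] : Prop :=
  ∀ x : X, (∀ φ : X →ₗ[R] C, φ x = 0) → x = 0

/-- A semidualizing module, in terms of `ExtVanish`. -/
structure SemiDual (R C : Type u) [CommRing R] [AddCommGroup C] [Module R C] : Prop where
  finite : Module.Finite R C
  bij : Function.Bijective (LinearMap.lsmul R C)
  ext : ∀ i : ℕ, ExtVanish R C C (i + 1)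

lemma _root_.Paper.IsSemidualizing.semiDual (h : Paper.IsSemidualizing R C) : SemiDual R C :=
  ⟨h.1, h.2.1, fun i => (extGrp_iff C C (i + 1)).1 (h.2.2 (i + 1) i.succ_pos)⟩

namespace SemiDual

/-- The homothety isomorphism. -/
def homothety (h : SemiDual R C) : R ≃ₗ[R] (C →ₗ[R] C) :=
  LinearEquiv.ofBijective (LinearMap.lsmul R C) h.bij

lemma homothety_apply (h : SemiDual R C) (r : R) (c : C) : h.homothety r c = r • c := rfl

lemma homothety_symm_smul (h : SemiDual R C) (φ : C →ₗ[R] C) (c : C) :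
    h.homothety.symm φ • c = φ c := by
  rw [← h.homothety_apply, LinearEquiv.apply_symm_apply]

lemma eq_zero_of_smul (h : SemiDual R C) (r : R) (hr : ∀ c : C, r • c = 0) : r = 0 := by
  apply h.homothety.injective
  ext c
  simpa [homothety_apply] using hr c

lemma subsingleton_of_hom [IsNoetherianRing R] (h : SemiDual R C) [Module.Finite R X]
    (hX : ∀ φ : C →ₗ[R] X, φ = 0) : Subsingleton X := by
  have := h.finite
  have hs : Subsingleton (C →ₗ[R] X) := ⟨fun a b => by rw [hX a, hX b]⟩
  obtain ⟨r, hr, hreg⟩ := IsSMulRegular.subsingleton_linearMap_iff.1 hs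
  obtain rfl := h.eq_zero_of_smul r (Module.mem_annihilator.1 hr)
  exact ⟨fun a b => hreg (by simp)⟩

lemma subsingleton_of_bilin [IsNoetherianRing R] (h : SemiDual R C) [Module.Finite R X]
    (hX : ∀ φ : C →ₗ[R] X →ₗ[R] X, φ = 0) : Subsingleton X := by
  have : Subsingleton (X →ₗ[R] X) := h.subsingleton_of_hom hX
  exact ⟨fun a b => by
    rw [← LinearMap.id_apply (R := R) a, ← LinearMap.id_apply (R := R) b,
      Subsingleton.elim (LinearMap.id : X →ₗ[R] X) 0]; rfl⟩

/-- The linear form `Y → R` associated with `C → Hom(Y, C)`. -/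
def toForm (h : SemiDual R C) (Φ : C →ₗ[R] (Y →ₗ[R] C)) : Y →ₗ[R] R :=
  h.homothety.symm.toLinearMap ∘ₗ Φ.flip

lemma toForm_smul (h : SemiDual R C) (Φ : C →ₗ[R] (Y →ₗ[R] C)) (y : Y) (c : C) :
    h.toForm Φ y • c = Φ c y := by
  simp [toForm, homothety_symm_smul]

end SemiDual

/-- The map `C → Hom(Y, C)` associated with a linear form `Y → R`. -/
def ofForm (C : Type u) [AddCommGroup C] [Module R C] (ψ : Y →ₗ[R] R) : C →ₗ[R] (Y →ₗ[R] C) :=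
  (LinearMap.lsmul R C ∘ₗ ψ).flip

lemma ofForm_apply (ψ : Y →ₗ[R] R) (c : C) (y : Y) : ofForm C ψ c y = ψ y • c := rfl

lemma exists_dual_basis (R Q : Type u) [CommRing R] [AddCommGroup Q] [Module R Q]
    [Module.Finite R Q] [Module.Projective R Q] :
    ∃ (b : ℕ) (e : Fin b → Q) (f : Fin b → Q →ₗ[R] R), ∀ x, x = ∑ j, f j x • e j := by
  obtain ⟨b, s, r, hrs⟩ := exists_retract_finFun R Q
  refine ⟨b, fun j => r (Pi.single j 1), fun j => LinearMap.proj j ∘ₗ s, fun x => ?_⟩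
  conv_lhs => rw [← LinearMap.id_apply (R := R) x, ← hrs, LinearMap.comp_apply,
    pi_eq_sum_univ' (s x)]
  simp only [map_sum, map_smul]
  refine Finset.sum_congr rfl fun j _ => ?_
  congr 2

lemma eq_sum_ofForm {b : ℕ} {e : Fin b → X} {f : Fin b → X →ₗ[R] R}
    (h : ∀ x, x = ∑ j, f j x • e j) (θ : X →ₗ[R] C) : θ = ∑ j, ofForm C (f j) (θ (e j)) := by
  ext x
  conv_lhs => rw [h x]
  simp [ofForm_apply]

lemma SemiDual.exists_eval_eq (h : SemiDual R C) [Module.Finite R X] [Module.Projective R X]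
    (Φ : (X →ₗ[R] C) →ₗ[R] C) : ∃ x : X, ∀ θ, Φ θ = θ x := by
  obtain ⟨b, e, f, hef⟩ := exists_dual_basis R X
  refine ⟨∑ j, h.homothety.symm (Φ ∘ₗ ofForm C (f j)) • e j, fun θ => ?_⟩
  conv_lhs => rw [eq_sum_ofForm hef θ]
  simp [homothety_symm_smul]

lemma SemiDual.torsionless_of_projective (h : SemiDual R C) [Module.Finite R X]
    [Module.Projective R X] : Torsionless R C X := by
  obtain ⟨b, e, f, hef⟩ := exists_dual_basis R X
  intro x hx
  rw [hef x]
  refine Finset.sum_eq_zero fun j _ => ?_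
  rw [h.eq_zero_of_smul (f j x) fun c => hx (ofForm C (f j) c), zero_smul]

section
variable {Q : Type u} [AddCommGroup Q] [Module R Q] {Y₁ : Type u} [AddCommGroup Y₁] [Module R Y₁]
  {ι : Y₁ →ₗ[R] Q} {g : Q →ₗ[R] Y}

lemma SemiDual.extVanish_range [Module.Finite R Q] [Module.Projective R Q] (h : SemiDual R C)
    (hs : IsSES ι g) (hY : ∀ i : ℕ, ExtVanish R C (Y →ₗ[R] C) (i + 1)) (i : ℕ) :
    ExtVanish R C (LinearMap.range (LinearMap.lcomp R C ι)) (i + 1) :=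
  hs.dual_rangeRestrict.cov_right ((h.ext i).homProjective Q) (hY (i + 1))

lemma SemiDual.extVanish_one_iff [IsNoetherianRing R] [Module.Finite R Q] [Module.Projective R Q]
    (h : SemiDual R C) (hs : IsSES ι g) (hY : ∀ i : ℕ, ExtVanish R C (Y →ₗ[R] C) (i + 1)) :
    ExtVanish R Y C 1 ↔ ExtVanish R Y R 1 := by
  have := h.finite
  have hfin : Module.Finite R Y₁ := Module.Finite.of_injective ι hs.inj
  constructor
  · intro hC
    refine hs.con_of_exists_ext (extVanish_of_projective 0) fun ψ => ?_
    obtain ⟨Φ, hΦ⟩ := (hs.dual hC).exists_lift (hY 0) (ofForm C ψ)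
    refine ⟨h.toForm Φ, ?_⟩
    ext y
    apply h.homothety.injective
    ext c
    rw [h.homothety_apply, h.homothety_apply, LinearMap.comp_apply, h.toForm_smul]
    exact LinearMap.congr_fun (LinearMap.congr_fun hΦ c) y
  · intro hR
    set r := LinearMap.lcomp R C ι with hr
    have hE : Subsingleton ((Y₁ →ₗ[R] C) ⧸ LinearMap.range r) := by
      refine h.subsingleton_of_hom fun φ => ?_
      obtain ⟨Φ, rfl⟩ := (IsSES.mkQ (LinearMap.range r)).exists_lift
        (h.extVanish_range hs hY 0) φ
      obtain ⟨ψ, hψ⟩ := hs.exists_ext hR (h.toForm Φ)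
      ext c
      simp only [LinearMap.comp_apply, Submodule.mkQ_apply, LinearMap.zero_apply,
        Submodule.Quotient.mk_eq_zero]
      refine ⟨ofForm C ψ c, ?_⟩
      ext y
      rw [hr, LinearMap.lcomp_apply, ofForm_apply, ← h.toForm_smul, ← hψ]
      rfl
    have hsurj : LinearMap.range r = ⊤ := Submodule.Quotient.subsingleton_iff.1 hE
    exact hs.con_of_exists_ext (extVanish_of_projective 0)
      fun φ => LinearMap.range_eq_top.1 hsurj φ

lemma IsSES.con_proj_iff [Module.Projective R Q] (hs : IsSES ι g) (i : ℕ) :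
    ExtVanish R Y Z (i + 2) ↔ ExtVanish R Y₁ Z (i + 1) :=
  ⟨fun h => hs.con_left (extVanish_of_projective i) h,
    fun h => hs.con_right h (extVanish_of_projective (i + 1))⟩

end

theorem SemiDual.extVanish_iff_ring [IsNoetherianRing R] (h : SemiDual R C) (n : ℕ) :
    ∀ (Y : Type u) [AddCommGroup Y] [Module R Y] [Module.Finite R Y],
      (∀ i : ℕ, ExtVanish R C (Y →ₗ[R] C) (i + 1)) →
      ((∀ i < n, ExtVanish R Y C (i + 1)) ↔ ∀ i < n, ExtVanish R Y R (i + 1)) := by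
  induction n with
  | zero => simp
  | succ n ih =>
    intro Y _ _ _ hY
    obtain ⟨b, g, hg⟩ := Module.Finite.exists_fin' R Y
    have hs := IsSES.kerSubtype hg
    have key : ExtVanish R Y C 1 → ∀ i : ℕ, ExtVanish R C (LinearMap.ker g →ₗ[R] C) (i + 1) :=
      fun h1 i => (hs.dual h1).cov_right ((h.ext i).homProjective _) (hY (i + 1))
    have split : ∀ Z : Type u, ∀ [AddCommGroup Z] [Module R Z],
        (∀ i < n + 1, ExtVanish R Y Z (i + 1)) ↔
          ExtVanish R Y Z 1 ∧ ∀ i < n, ExtVanish R (LinearMap.ker g) Z (i + 1) := by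
      intro Z _ _
      constructor
      · exact fun H => ⟨H 0 n.succ_pos, fun i hi => (hs.con_proj_iff i).1 (H (i + 1) (by omega))⟩
      · rintro ⟨H0, H⟩ (_ | i) hi
        · exact H0
        · exact (hs.con_proj_iff i).2 (H i (by omega))
    rw [split, split, ← h.extVanish_one_iff hs hY]
    exact and_congr_right fun h1 => ih _ (key h1)

end

section

variable {R : Type u} [CommRing R]
variable {A B D X Y Z C M : Type u} [AddCommGroup A] [AddCommGroup B] [AddCommGroup D]
  [AddCommGroup X] [AddCommGroup Y] [AddCommGroup Z] [AddCommGroup C] [AddCommGroup M]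
  [Module R A] [Module R B] [Module R D] [Module R X] [Module R Y] [Module R Z] [Module R C]
  [Module R M]


section projective_cover

variable {P P' : Type u} [AddCommGroup P] [Module R P] [AddCommGroup P'] [Module R P']

lemma exists_equiv_of_projective_cover [Module.Projective R P] [Module.Projective R P']
    (g : P →ₗ[R] X) (g' : P' →ₗ[R] X) (hg : Function.Surjective g) (hg' : Function.Surjective g')
    (hm : ∀ N : Submodule R P, N ⊔ LinearMap.ker g = ⊤ → N = ⊤)
    (hm' : ∀ N : Submodule R P', N ⊔ LinearMap.ker g' = ⊤ → N = ⊤) :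
    ∃ e : P ≃ₗ[R] P', g' ∘ₗ e.toLinearMap = g := by
  have key : ∀ {P P' : Type u} [AddCommGroup P] [Module R P] [AddCommGroup P'] [Module R P']
      (g : P →ₗ[R] X) (g' : P' →ₗ[R] X) (_ : Function.Surjective g)
      (_ : ∀ N : Submodule R P', N ⊔ LinearMap.ker g' = ⊤ → N = ⊤) (φ : P →ₗ[R] P')
      (_ : g' ∘ₗ φ = g), Function.Surjective φ := by
    intro P P' _ _ _ _ g g' hg hm' φ hφ
    rw [← LinearMap.range_eq_top]
    apply hm'
    rw [eq_top_iff]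
    intro x _
    obtain ⟨y, hy⟩ := hg (g' x)
    have : x = φ y + (x - φ y) := by abel
    rw [this]
    refine Submodule.add_mem_sup ⟨y, rfl⟩ ?_
    rw [LinearMap.mem_ker, map_sub, ← LinearMap.comp_apply, hφ, hy, sub_self]
  obtain ⟨φ, hφ⟩ := Module.projective_lifting_property g' g hg'
  have hφs := key g g' hg hm' φ hφ
  obtain ⟨σ, hσ⟩ := Module.projective_lifting_property φ LinearMap.id hφs
  have hgσ : g ∘ₗ σ = g' := by rw [← hφ, LinearMap.comp_assoc, hσ, LinearMap.comp_id]
  have hσs := key g' g hg' hm σ hgσ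
  refine ⟨LinearEquiv.ofBijective φ ⟨?_, hφs⟩, hφ⟩
  intro a b hab
  obtain ⟨a, rfl⟩ := hσs a
  obtain ⟨b, rfl⟩ := hσs b
  rw [← LinearMap.comp_apply, ← LinearMap.comp_apply, hσ] at hab
  exact congrArg σ hab

lemma minPres_unique (C : Type u) [AddCommGroup C] [Module R C] (p q : Paper.MinPres R X) :
    Nonempty (LinearMap.range (p.homC C) ≃ₗ[R] LinearMap.range (q.homC C)) := by
  have := p.proj₀
  have := q.proj₀
  have := p.proj₁
  have := q.proj₁
  obtain ⟨e, he⟩ := exists_equiv_of_projective_cover p.g q.g p.surj q.surj p.min₀ q.min₀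
  have hp : ∀ x, (e.toLinearMap ∘ₗ p.f) x ∈ LinearMap.ker q.g := by
    intro x
    rw [LinearMap.mem_ker, LinearMap.comp_apply, ← LinearMap.comp_apply q.g, he]
    have : p.f x ∈ LinearMap.ker p.g := p.exact ▸ ⟨x, rfl⟩
    exact this
  have hq : ∀ x, q.f x ∈ LinearMap.ker q.g := fun x => q.exact ▸ ⟨x, rfl⟩
  obtain ⟨e₁, he₁⟩ := exists_equiv_of_projective_cover
    ((e.toLinearMap ∘ₗ p.f).codRestrict _ hp) (q.f.codRestrict _ hq)
    (by
      rintro ⟨x, hx⟩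
      have hx' : e.symm x ∈ LinearMap.ker p.g := by
        rw [LinearMap.mem_ker, ← he]
        simpa using hx
      rw [← p.exact] at hx'
      obtain ⟨y, hy⟩ := hx'
      refine ⟨y, Subtype.ext ?_⟩
      simp [hy])
    (by
      rintro ⟨x, hx⟩
      obtain ⟨y, hy⟩ : x ∈ LinearMap.range q.f := q.exact ▸ hx
      exact ⟨y, Subtype.ext hy⟩)
    (by
      intro N hN
      apply p.min₁
      rwa [LinearMap.ker_codRestrict, LinearMap.ker_comp_of_ker_eq_bot _ e.ker] at hN)
    (by
      intro N hN
      apply q.min₁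
      rwa [LinearMap.ker_codRestrict] at hN)
  have hcomm : ∀ x, q.f (e₁ x) = e (p.f x) := fun x =>
    congrArg Subtype.val (LinearMap.congr_fun he₁ x)
  have hsymm : ∀ x, e.symm (q.f x) = p.f (e₁.symm x) := fun x => by
    rw [LinearEquiv.symm_apply_eq, ← hcomm, e₁.apply_symm_apply]
  refine ⟨LinearEquiv.ofSubmodules (e₁.congrLeft C R) _ _ ?_⟩
  ext φ
  constructor
  · rintro ⟨_, ⟨ψ, rfl⟩, rfl⟩
    refine ⟨ψ ∘ₗ e.symm.toLinearMap, ?_⟩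
    ext x
    simp [Paper.MinPres.homC, LinearEquiv.congrLeft, hsymm]
  · rintro ⟨ψ, rfl⟩
    refine ⟨_, ⟨ψ ∘ₗ e.toLinearMap, rfl⟩, ?_⟩
    ext x
    simp [Paper.MinPres.homC, LinearEquiv.congrLeft, ← hcomm]

end projective_cover

lemma isLambdaOf_unique {N N' : Type u} [AddCommGroup N] [Module R N] [AddCommGroup N']
    [Module R N'] (h : Paper.IsLambdaOf R C M N) (h' : Paper.IsLambdaOf R C M N') :
    Nonempty (N ≃ₗ[R] N') := by
  obtain ⟨p, ⟨e⟩⟩ := h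
  obtain ⟨q, ⟨e'⟩⟩ := h'
  obtain ⟨ε⟩ := minPres_unique C p q
  exact ⟨e.trans (ε.trans e'.symm)⟩

/-- The data relating a linked module `M` to `Y = Hom(C, λ M)`. -/
structure LinkData (R C M Y Q : Type u) [CommRing R] [AddCommGroup C] [Module R C]
    [AddCommGroup M] [Module R M] [AddCommGroup Y] [Module R Y] [AddCommGroup Q] [Module R Q] where
  g : Q →ₗ[R] Y
  ρ : (Q →ₗ[R] C) →ₗ[R] M
  surj : Function.Surjective g
  ses : IsSES (LinearMap.lcomp R C g) ρ
  finite : Module.Finite R Q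
  proj : Module.Projective R Q
  torsionless : Torsionless R C Y

lemma exists_linkData {N : Type u} [AddCommGroup N] [Module R N]
    (h : Paper.IsLambdaOf R C M N) (h' : Paper.IsLambdaOf R C N M) :
    ∃ (Q : ModuleCat.{u} R), Nonempty (LinkData R C M (C →ₗ[R] N) Q) := by
  obtain ⟨p, ⟨e⟩⟩ := h
  obtain ⟨q, ⟨e'⟩⟩ := h'
  refine ⟨ModuleCat.of R q.P₀, ⟨⟨q.g, e'.symm.toLinearMap ∘ₗ (q.homC C).rangeRestrict, q.surj,
    ⟨?_, ?_, ?_⟩, q.finite₀, q.proj₀, ?_⟩⟩⟩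
  · exact (IsSES.kerSubtype q.surj).lcomp_injective
  · intro φ
    rw [← (IsSES.kerSubtype q.surj).lcomp_exact φ]
    simp only [LinearMap.comp_apply, LinearEquiv.coe_coe, LinearEquiv.map_eq_zero_iff]
    rw [← Subtype.coe_inj]
    constructor
    · intro H
      ext ⟨x, hx⟩
      obtain ⟨y, rfl⟩ : x ∈ LinearMap.range q.f := q.exact ▸ hx
      exact LinearMap.congr_fun H y
    · intro H
      ext x
      have : q.f x ∈ LinearMap.ker q.g := q.exact ▸ ⟨x, rfl⟩
      exact LinearMap.congr_fun H ⟨_, this⟩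
  · exact e'.symm.surjective.comp (LinearMap.surjective_rangeRestrict _)
  · intro y hy
    ext c
    apply e.injective
    rw [LinearMap.zero_apply, map_zero]
    apply Subtype.ext
    ext x
    let ε : N →ₗ[R] (p.P₁ →ₗ[R] C) := (LinearMap.range (p.homC C)).subtype ∘ₗ e.toLinearMap
    let α : (p.P₁ →ₗ[R] C) →ₗ[R] C := LinearMap.applyₗ x
    let β : (C →ₗ[R] N) →ₗ[R] N := LinearMap.applyₗ c
    exact hy (α ∘ₗ ε ∘ₗ β)

lemma finite_of_isLambdaOf [IsNoetherianRing R] [Module.Finite R C] {N : Type u} [AddCommGroup N]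
    [Module R N] (h : Paper.IsLambdaOf R C M N) : Module.Finite R N := by
  obtain ⟨p, ⟨e⟩⟩ := h
  have := p.finite₁
  let ε : N →ₗ[R] (p.P₁ →ₗ[R] C) := (LinearMap.range (p.homC C)).subtype ∘ₗ e.toLinearMap
  exact Module.Finite.of_injective ε ((Submodule.injective_subtype _).comp e.injective)

section

variable {Q : Type u} [AddCommGroup Q] [Module R Q]

lemma SemiDual.exists_lift_of_bass [IsNoetherianRing R] (h : SemiDual R C) [Module.Finite R M]
    [Module.Finite R Q] [Module.Projective R Q]
    (hev : Function.Injective (Paper.evalMap R C M)) (ρ : (Q →ₗ[R] C) →ₗ[R] M)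
    (hρ : Function.Surjective ρ) (φ : C →ₗ[R] M) : ∃ ψ : C →ₗ[R] (Q →ₗ[R] C), ρ ∘ₗ ψ = φ := by
  have := h.finite
  let W : Submodule R (C →ₗ[R] M) := LinearMap.range (LinearMap.compRight R (M := C) ρ)
  suffices Subsingleton ((C →ₗ[R] M) ⧸ W) by
    have hW : W = ⊤ := Submodule.Quotient.subsingleton_iff.1 this
    obtain ⟨ψ, hψ⟩ : φ ∈ W := hW ▸ Submodule.mem_top
    exact ⟨ψ, hψ⟩
  have hspan : ∀ t : TensorProduct R C (C →ₗ[R] M),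
      t ∈ Submodule.span R {t | ∃ c : C, ∃ w ∈ W, c ⊗ₜ[R] w = t} := by
    intro t
    obtain ⟨b, e, f, hef⟩ := exists_dual_basis R Q
    obtain ⟨θ, hθ⟩ := hρ (Paper.evalMap R C M t)
    have ht : t = ∑ j, θ (e j) ⊗ₜ[R] (ρ ∘ₗ ofForm C (f j)) := by
      apply hev
      rw [← hθ]
      conv_lhs => rw [eq_sum_ofForm hef θ]
      simp [Paper.evalMap]
    rw [ht]
    exact Submodule.sum_mem _ fun j _ => Submodule.subset_span ⟨_, _, ⟨_, rfl⟩, rfl⟩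
  refine h.subsingleton_of_bilin fun β => ?_
  let β' : TensorProduct R C (C →ₗ[R] M) →ₗ[R] ((C →ₗ[R] M) ⧸ W) :=
    TensorProduct.lift ((LinearMap.lcomp R _ W.mkQ) ∘ₗ β)
  have hβ' : β' = 0 := by
    ext c x
    have := hspan (c ⊗ₜ[R] x)
    have hle : Submodule.span R {t | ∃ c : C, ∃ w ∈ W, c ⊗ₜ[R] w = t} ≤ LinearMap.ker β' := by
      rw [Submodule.span_le]
      rintro _ ⟨c, w, hw, rfl⟩
      have : (Submodule.Quotient.mk w : (C →ₗ[R] M) ⧸ W) = 0 :=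
        (Submodule.Quotient.mk_eq_zero W).2 hw
      simp [β', this]
    exact hle this
  ext c x
  have := LinearMap.congr_fun hβ' (c ⊗ₜ[R] x)
  simpa [β'] using this

namespace LinkData

lemma extVanish_dual (L : LinkData R C M Y Q) [IsNoetherianRing R] (h : SemiDual R C)
    [Module.Finite R M] (hev : Function.Injective (Paper.evalMap R C M))
    (hM : ∀ i : ℕ, ExtVanish R C M (i + 1)) (i : ℕ) : ExtVanish R C (Y →ₗ[R] C) (i + 1) := by
  have := L.finite
  have := L.proj
  cases i with
  | zero => exact L.ses.cov_of_exists_lift ((h.ext 0).homProjective Q)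
              (fun φ => h.exists_lift_of_bass hev L.ρ L.ses.surj φ)
  | succ i => exact L.ses.cov_left (hM i) ((h.ext (i + 1)).homProjective Q)

end LinkData
end

end

section

variable {R : Type u} [CommRing R]
variable {A B D X Y Z C M : Type u} [AddCommGroup A] [AddCommGroup B] [AddCommGroup D]
  [AddCommGroup X] [AddCommGroup Y] [AddCommGroup Z] [AddCommGroup C] [AddCommGroup M]
  [Module R A] [Module R B] [Module R D] [Module R X] [Module R Y] [Module R Z] [Module R C]
  [Module R M]

/-- `Hom(R^b, C) ≅ R^b ⊗ C`. -/
def dualFinFunEquiv (R C : Type u) [CommRing R] [AddCommGroup C] [Module R C] (b : ℕ) :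
    ((Fin b → R) →ₗ[R] C) ≃ₗ[R] TensorProduct R (Fin b → R) C :=
  (LinearEquiv.piRing R C (Fin b) R).trans
    ((TensorProduct.piScalarRight R R C (Fin b)).symm.trans (TensorProduct.comm R C (Fin b → R)))

theorem isNthCSyzygyAux_of_dual [IsNoetherianRing R] (n : ℕ) :
    ∀ (B T : Type u) [AddCommGroup B] [Module R B] [AddCommGroup T] [Module R T]
      [Module.Finite R T] (β : B →ₗ[R] (T →ₗ[R] C)), Function.Injective β →
      (2 ≤ n → Function.Surjective β) → (∀ i, i + 3 ≤ n → ExtVanish R T C (i + 1)) →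
      Paper.IsNthCSyzygyAux R C n (ModuleCat.of R B) := by
  induction n with
  | zero => intros; trivial
  | succ n ih =>
    intro B T _ _ _ _ _ β hβ hβs hT
    obtain ⟨b, g, hg⟩ := Module.Finite.exists_fin' R T
    have hs := IsSES.kerSubtype hg
    let e := dualFinFunEquiv R C b
    let ι : B →ₗ[R] TensorProduct R (Fin b → R) C :=
      e.toLinearMap ∘ₗ LinearMap.lcomp R C g ∘ₗ β
    refine ⟨ModuleCat.of R (Fin b → R), inferInstanceAs (Module.Projective R (Fin b → R)), ι,
      e.injective.comp (hs.lcomp_injective.comp hβ), ?_⟩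
    rcases Nat.eq_zero_or_pos n with rfl | hn
    · trivial
    let δ : TensorProduct R (Fin b → R) C →ₗ[R] (LinearMap.ker g →ₗ[R] C) :=
      LinearMap.lcomp R C (LinearMap.ker g).subtype ∘ₗ e.symm.toLinearMap
    have hδ : LinearMap.ker δ = LinearMap.range ι := by
      ext t
      have : t ∈ LinearMap.ker δ ↔ e.symm t ∈ Set.range (LinearMap.lcomp R C g) :=
        hs.lcomp_exact (e.symm t)
      rw [this]
      constructor
      · rintro ⟨φ, hφ⟩
        obtain ⟨x, rfl⟩ := hβs (by omega) φ
        exact ⟨x, by simp only [ι, LinearMap.comp_apply, hφ]; simp⟩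
      · rintro ⟨x, rfl⟩
        exact ⟨β x, by simp [ι]⟩
    refine ih _ (LinearMap.ker g) ((LinearMap.range ι).liftQ δ hδ.ge) ?_ ?_ ?_
    · rw [← LinearMap.ker_eq_bot, Submodule.ker_liftQ_eq_bot _ _ _ hδ.le]
    · intro h2
      rw [← LinearMap.range_eq_top, Submodule.range_liftQ, LinearMap.range_eq_top]
      exact (hs.dual (hT 0 (by omega))).surj.comp e.symm.surjective
    · intro i hi
      exact (hs.con_proj_iff i).1 (hT (i + 1) (by omega))

namespace LinkData

variable {Q : Type u} [AddCommGroup Q] [Module R Q]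

lemma isNthCSyzygy (L : LinkData R C M Y Q) [IsNoetherianRing R] (n : ℕ)
    (h : ∀ i, i + 1 < n → ExtVanish R Y C (i + 1)) :
    Paper.IsNthCSyzygy R n C M := by
  have := L.finite
  have := L.proj
  have hs := IsSES.kerSubtype L.surj
  let r := LinearMap.lcomp R C (LinearMap.ker L.g).subtype
  have hle : LinearMap.ker L.ρ ≤ LinearMap.ker r := fun x hx =>
    (hs.lcomp_exact x).2 ((L.ses.exact x).1 hx)
  have hge : LinearMap.ker r ≤ LinearMap.ker L.ρ := fun x hx =>
    (L.ses.exact x).2 ((hs.lcomp_exact x).1 hx)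
  let e := L.ρ.quotKerEquivOfSurjective L.ses.surj
  refine isNthCSyzygyAux_of_dual n M (LinearMap.ker L.g)
    ((LinearMap.ker L.ρ).liftQ r hle ∘ₗ e.symm.toLinearMap) ?_ ?_ ?_
  · suffices H : Function.Injective ((LinearMap.ker L.ρ).liftQ r hle) from
      H.comp e.symm.injective
    rw [← LinearMap.ker_eq_bot, Submodule.ker_liftQ_eq_bot _ _ _ hge]
  · intro hn
    suffices H : Function.Surjective ((LinearMap.ker L.ρ).liftQ r hle) from
      H.comp e.symm.surjective
    rw [← LinearMap.range_eq_top, Submodule.range_liftQ, LinearMap.range_eq_top]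
    exact (hs.dual (h 0 (by omega))).surj
  · exact fun i hi => (hs.con_proj_iff i).1 (h (i + 1) (by omega))

lemma exists_equiv_dual (L : LinkData R C M Y Q) (h : SemiDual R C) :
    ∃ e : LinearMap.ker L.g ≃ₗ[R] (M →ₗ[R] C), ∀ q θ, e q (L.ρ θ) = θ q := by
  have := L.finite
  have := L.proj
  let j : LinearMap.ker L.g →ₗ[R] ((Q →ₗ[R] C) →ₗ[R] C) :=
    Paper.bidualityMap R C Q ∘ₗ (LinearMap.ker L.g).subtype
  have hj : Function.Injective j := by
    rw [← LinearMap.ker_eq_bot, LinearMap.ker_eq_bot']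
    intro q hq
    apply Subtype.ext
    exact h.torsionless_of_projective (q : Q) fun φ => LinearMap.congr_fun hq φ
  let k := LinearMap.lcomp R C L.ρ
  have hk : Function.Injective k := L.ses.lcomp_injective
  have hr : LinearMap.range j = LinearMap.range k := by
    ext Φ
    have h1 : Φ ∈ LinearMap.range k ↔ LinearMap.lcomp R C (LinearMap.lcomp R C L.g) Φ = 0 :=
      (L.ses.lcomp_exact Φ).symm
    rw [h1]
    constructor
    · rintro ⟨⟨q, hq⟩, rfl⟩
      ext φ
      have : L.g q = 0 := hq
      simp [j, Paper.bidualityMap, this]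
    · intro hΦ
      obtain ⟨q, hq⟩ := h.exists_eval_eq Φ
      refine ⟨⟨q, L.torsionless _ fun φ => ?_⟩, ?_⟩
      · have := LinearMap.congr_fun hΦ φ
        rw [LinearMap.lcomp_apply, LinearMap.lcomp_apply', hq] at this
        exact this
      · ext θ
        exact (hq θ).symm
  refine ⟨(LinearEquiv.ofInjective j hj).trans ((LinearEquiv.ofEq _ _ hr).trans
    (LinearEquiv.ofInjective k hk).symm), fun q θ => ?_⟩
  have : k ((LinearEquiv.ofInjective k hk).symm
      (LinearEquiv.ofEq _ _ hr (LinearEquiv.ofInjective j hj q))) = j q := by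
    have := congrArg Subtype.val ((LinearEquiv.ofInjective k hk).apply_symm_apply
      (LinearEquiv.ofEq _ _ hr (LinearEquiv.ofInjective j hj q)))
    exact this
  exact LinearMap.congr_fun this θ

lemma extVanish_of_dual (L : LinkData R C M Y Q) (h : SemiDual R C) (n : ℕ)
    (hs : 2 ≤ n → Function.Surjective (Paper.bidualityMap R C M))
    (hd : ∀ i, i + 3 ≤ n → ExtVanish R (M →ₗ[R] C) C (i + 1)) :
    ∀ i, i + 1 < n → ExtVanish R Y C (i + 1) := by
  have := L.proj
  have hses := IsSES.kerSubtype L.surj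
  obtain ⟨e, he⟩ := L.exists_equiv_dual h
  rintro (_ | i) hi
  · refine hses.con_of_exists_ext (extVanish_of_projective 0) fun φ => ?_
    obtain ⟨m, hm⟩ := hs (by omega) (φ ∘ₗ e.symm.toLinearMap)
    obtain ⟨θ, rfl⟩ := L.ses.surj m
    refine ⟨θ, ?_⟩
    ext q
    have := LinearMap.congr_fun hm (e q)
    simp only [LinearMap.comp_apply, LinearEquiv.coe_coe, LinearEquiv.symm_apply_apply] at this
    rw [← this, LinearMap.comp_apply]
    exact (he q θ).symm
  · exact (hses.con_proj_iff i).2 ((hd i (by omega)).congr_left e.symm)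

end LinkData

end

section

variable {R : Type u} [CommRing R]
variable {A B D X Y Z C M : Type u} [AddCommGroup A] [AddCommGroup B] [AddCommGroup D]
  [AddCommGroup X] [AddCommGroup Y] [AddCommGroup Z] [AddCommGroup C] [AddCommGroup M]
  [Module R A] [Module R B] [Module R D] [Module R X] [Module R Y] [Module R Z] [Module R C]
  [Module R M]

/-- A homomorphism `M → C^b` through which all homomorphisms `M → C` factor. -/
def IsUniversal {b : ℕ} (α : M →ₗ[R] (Fin b → C)) : Prop :=
  Function.Surjective (LinearMap.lcomp R C α)

lemma exists_eq_sum_proj {b : ℕ} (h : SemiDual R C) (φ : (Fin b → C) →ₗ[R] C) :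
    ∃ c : Fin b → R, φ = ∑ j, c j • LinearMap.proj j := by
  refine ⟨fun j => h.homothety.symm (φ ∘ₗ LinearMap.single R (fun _ => C) j), ?_⟩
  ext j x
  simp only [LinearMap.comp_apply, LinearMap.sum_apply, LinearMap.smul_apply, LinearMap.proj_apply,
    SemiDual.homothety_symm_smul]
  rw [Finset.sum_eq_single j]
  · simp
  · intro k _ hk
    simp [hk]
  · simp

lemma exists_universal [IsNoetherianRing R] [Module.Finite R C] [Module.Finite R M] :
    ∃ (b : ℕ) (α : M →ₗ[R] (Fin b → C)), IsUniversal α := by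
  obtain ⟨b, ξ, hξ⟩ := Module.Finite.exists_fin (R := R) (M := M →ₗ[R] C)
  refine ⟨b, LinearMap.pi ξ, fun φ => ?_⟩
  obtain ⟨c, hc⟩ := (Submodule.mem_span_range_iff_exists_fun R).1
    (hξ ▸ Submodule.mem_top : φ ∈ Submodule.span R (Set.range ξ))
  refine ⟨∑ j, c j • LinearMap.proj j, ?_⟩
  rw [← hc]
  ext m
  simp

lemma IsUniversal.injective {b : ℕ} {α : M →ₗ[R] (Fin b → C)} (hα : IsUniversal α)
    (hM : Torsionless R C M) : Function.Injective α := by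
  rw [← LinearMap.ker_eq_bot, LinearMap.ker_eq_bot']
  intro m hm
  refine hM m fun φ => ?_
  obtain ⟨ψ, rfl⟩ := hα φ
  simp [hm]

lemma IsUniversal.surjective_biduality [IsNoetherianRing R] {b : ℕ} {α : M →ₗ[R] (Fin b → C)}
    (h : SemiDual R C) (hα : IsUniversal α)
    (hM : Torsionless R C ((Fin b → C) ⧸ LinearMap.range α)) :
    Function.Surjective (Paper.bidualityMap R C M) := by
  intro Φ
  let x : Fin b → C := fun j => Φ (LinearMap.proj j ∘ₗ α)
  have hx : ∀ ψ : (Fin b → C) →ₗ[R] C, Φ (ψ ∘ₗ α) = ψ x := by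
    intro ψ
    obtain ⟨c, rfl⟩ := exists_eq_sum_proj h ψ
    have hc : (∑ j, c j • LinearMap.proj j : (Fin b → C) →ₗ[R] C) ∘ₗ α =
        ∑ j, c j • (LinearMap.proj j ∘ₗ α) := by
      ext m
      simp
    rw [hc]
    simp [x]
  have hxr : x ∈ LinearMap.range α := by
    rw [← Submodule.Quotient.mk_eq_zero]
    refine hM _ fun φ => ?_
    have := hx (φ ∘ₗ (LinearMap.range α).mkQ)
    rw [LinearMap.comp_assoc, LinearMap.range_mkQ_comp, LinearMap.comp_zero, map_zero] at this
    exact this.symm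
  obtain ⟨m, hm⟩ := hxr
  refine ⟨m, ?_⟩
  ext φ
  obtain ⟨ψ, rfl⟩ := hα φ
  rw [LinearMap.lcomp_apply', hx, ← hm]
  rfl

lemma SemiDual.projective_dual (h : SemiDual R C) (b : ℕ) :
    Module.Projective R ((Fin b → C) →ₗ[R] C) :=
  Module.Projective.of_equiv
    ((LinearEquiv.piCongrRight fun _ : Fin b => h.homothety).trans
      (LinearMap.lsum R (fun _ : Fin b => C) R))

theorem pushforward_induction [IsNoetherianRing R] (h : SemiDual R C)
    (Inv : ℕ → ModuleCat.{u} R → Prop)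
    (htl : ∀ (n : ℕ) (M : Type u) [AddCommGroup M] [Module R M] [Module.Finite R M],
      Inv (n + 1) (ModuleCat.of R M) → Torsionless R C M)
    (hstep : ∀ (n : ℕ) (M : Type u) [AddCommGroup M] [Module R M] [Module.Finite R M],
      Inv (n + 1) (ModuleCat.of R M) → ∀ (b : ℕ) (α : M →ₗ[R] (Fin b → C)), IsUniversal α →
        Function.Injective α → Inv n (ModuleCat.of R ((Fin b → C) ⧸ LinearMap.range α)))
    (n : ℕ) :
    ∀ (M : Type u) [AddCommGroup M] [Module R M] [Module.Finite R M],
      Inv n (ModuleCat.of R M) →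
      (2 ≤ n → Function.Surjective (Paper.bidualityMap R C M)) ∧
      (∀ i, i + 3 ≤ n → ExtVanish R (M →ₗ[R] C) C (i + 1)) := by
  induction n with
  | zero => exact fun M _ _ _ _ => ⟨by omega, by omega⟩
  | succ n ih =>
    intro M _ _ _ hInv
    have := h.finite
    have := h.projective_dual
    obtain ⟨b, α, hα⟩ := exists_universal (R := R) (C := C) (M := M)
    have hM := htl n M hInv
    have hinj := hα.injective hM
    have hInv' := hstep n M hInv b α hα hinj
    obtain ⟨h2, h3⟩ := ih _ hInv'
    have hs := (IsSES.rangeMkQ hinj).dual_of_surjective hα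
    refine ⟨fun hn => ?_, ?_⟩
    · obtain ⟨n, rfl⟩ : ∃ k, n = k + 1 := ⟨n - 1, by omega⟩
      exact hα.surjective_biduality h (htl n _ hInv')
    · rintro (_ | i) hi
      · refine hs.con_of_exists_ext (extVanish_of_projective 0) fun φ => ?_
        obtain ⟨m, rfl⟩ := h2 (by omega) φ
        obtain ⟨x, rfl⟩ := Submodule.mkQ_surjective _ m
        exact ⟨LinearMap.applyₗ x, rfl⟩
      · exact (hs.con_proj_iff i).2 (h3 i (by omega))

end

section

variable {R : Type u} [CommRing R]
variable {A B D X Y Z C M : Type u} [AddCommGroup A] [AddCommGroup B] [AddCommGroup D]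
  [AddCommGroup X] [AddCommGroup Y] [AddCommGroup Z] [AddCommGroup C] [AddCommGroup M]
  [Module R A] [Module R B] [Module R D] [Module R X] [Module R Y] [Module R Z] [Module R C]
  [Module R M]

section AddClosure

/-- `D` is a direct summand of a direct sum of copies of `C`. -/
def AddC (R C D : Type u) [CommRing R] [AddCommGroup C] [Module R C] [AddCommGroup D]
    [Module R D] : Prop :=
  ∃ (I : Type u) (s : D →ₗ[R] (I →₀ C)) (r : (I →₀ C) →ₗ[R] D), r ∘ₗ s = LinearMap.id

lemma AddC.torsionless (h : AddC R C D) : Torsionless R C D := by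
  obtain ⟨I, s, r, hrs⟩ := h
  intro d hd
  rw [← LinearMap.id_apply (R := R) d, ← hrs, LinearMap.comp_apply]
  have : s d = 0 := by
    ext i
    exact hd (Finsupp.lapply i ∘ₗ s)
  rw [this, map_zero]

lemma exists_factor_of_finite [Module.Finite R X] {I : Type u} (φ : X →ₗ[R] (I →₀ C)) :
    ∃ (b : ℕ) (j : Fin b → I) (ψ : Fin b → (X →ₗ[R] C)),
      φ = ∑ k, Finsupp.lsingle (j k) ∘ₗ ψ k := by
  classical
  obtain ⟨t, ht⟩ := Module.Finite.fg_top (R := R) (M := X)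
  let F : Finset I := t.biUnion fun x => (φ x).support
  have hF : ∀ x, (φ x).support ⊆ F := by
    intro x
    have : x ∈ Submodule.comap φ (Finsupp.supported C R (F : Set I)) := by
      have : Submodule.span R (t : Set X) ≤ Submodule.comap φ (Finsupp.supported C R (F : Set I)) :=
        Submodule.span_le.2 fun x hx => by
          simp only [Submodule.comap_coe, Set.mem_preimage, SetLike.mem_coe, Finsupp.mem_supported]
          exact_mod_cast Finset.subset_biUnion_of_mem (fun x => (φ x).support) hx
      exact this (ht ▸ Submodule.mem_top)
    simpa [Finsupp.mem_supported] using this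
  refine ⟨F.card, fun k => F.equivFin.symm k, fun k => Finsupp.lapply (F.equivFin.symm k : I) ∘ₗ φ,
    ?_⟩
  apply LinearMap.ext
  intro x
  simp only [LinearMap.sum_apply, LinearMap.comp_apply, Finsupp.lsingle_apply,
    Finsupp.lapply_apply]
  rw [Equiv.sum_comp F.equivFin.symm (fun i : F => Finsupp.single (i : I) (φ x i)),
    Finset.sum_coe_sort F (fun i => Finsupp.single i (φ x i))]
  conv_lhs => rw [← Finsupp.sum_single (φ x)]
  exact Finset.sum_subset (hF x) fun i _ hi => by simp [Finsupp.notMem_support_iff.1 hi]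

lemma exists_extension_addC [Module.Finite R X] {ι : X →ₗ[R] Y} (hD : AddC R C D)
    (hext : ∀ φ : X →ₗ[R] C, ∃ ψ : Y →ₗ[R] C, ψ ∘ₗ ι = φ) (φ : X →ₗ[R] D) :
    ∃ ψ : Y →ₗ[R] D, ψ ∘ₗ ι = φ := by
  obtain ⟨I, s, r, hrs⟩ := hD
  obtain ⟨b, j, ψ, hψ⟩ := exists_factor_of_finite (s ∘ₗ φ)
  choose χ hχ using fun k => hext (ψ k)
  refine ⟨r ∘ₗ ∑ k, Finsupp.lsingle (j k) ∘ₗ χ k, ?_⟩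
  have h1 : (∑ k, Finsupp.lsingle (j k) ∘ₗ χ k) ∘ₗ ι = s ∘ₗ φ := by
    rw [hψ]
    apply LinearMap.ext
    intro x
    simp [← hχ]
  rw [LinearMap.comp_assoc, h1, ← LinearMap.comp_assoc, hrs, LinearMap.id_comp]

lemma ExtVanish.addC [IsNoetherianRing R] (hD : AddC R C D) (i : ℕ) :
    ∀ (X : Type u) [AddCommGroup X] [Module R X] [Module.Finite R X],
      ExtVanish R X C i → ExtVanish R X D i := by
  match i with
  | 0 =>
    intro X _ _ _ h
    rw [extVanish_zero_iff] at h ⊢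
    intro φ
    ext x
    exact hD.torsionless _ fun ψ => LinearMap.congr_fun (h (ψ ∘ₗ φ)) x
  | 1 =>
    intro X _ _ _ h
    obtain ⟨b, p, hp⟩ := Module.Finite.exists_fin' R X
    have hs := IsSES.kerSubtype hp
    exact hs.con_of_exists_ext (extVanish_of_projective 0) fun φ =>
      exists_extension_addC hD (fun φ => hs.exists_ext h φ) φ
  | i + 2 =>
    intro X _ _ _ h
    obtain ⟨b, p, hp⟩ := Module.Finite.exists_fin' R X
    have hs := IsSES.kerSubtype hp
    exact (hs.con_proj_iff i).2 (ExtVanish.addC hD (i + 1) _ ((hs.con_proj_iff i).1 h))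

/-- `V` is the beginning of an exact sequence `0 → V → D₁ → ⋯ → D_n` whose terms are summands
of direct sums of copies of `C`. -/
def CSyz (R : Type u) [CommRing R] (C : Type u) [AddCommGroup C] [Module R C] :
    ℕ → ModuleCat.{u} R → Prop
  | 0, _ => True
  | n + 1, V => ∃ (D : ModuleCat.{u} R) (W : ModuleCat.{u} R) (f : V →ₗ[R] D) (g : D →ₗ[R] W),
      AddC R C D ∧ IsSES f g ∧ CSyz R C n W

lemma CSyz.extVanish [IsNoetherianRing R] [Module.Finite R X] {n t : ℕ}
    (hX : ∀ i < t, ExtVanish R X C i) {V : ModuleCat.{u} R} (hV : CSyz R C n V) (i : ℕ)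
    (hn : i < n) (ht : i < t) : ExtVanish R X V i := by
  induction n generalizing V i with
  | zero => omega
  | succ n ih =>
    obtain ⟨D, W, f, g, hD, hfg, hW⟩ := hV
    cases i with
    | zero =>
      have h0 := ExtVanish.addC hD 0 X (hX 0 ht)
      rw [extVanish_zero_iff] at h0 ⊢
      intro φ
      ext x
      apply hfg.inj
      rw [LinearMap.zero_apply, map_zero]
      exact LinearMap.congr_fun (h0 (f ∘ₗ φ)) x
    | succ i =>
      exact hfg.cov_left (ih hW i (by omega) (by omega)) (ExtVanish.addC hD (i + 1) X (hX _ ht))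

end AddClosure

section Localization

variable (S : Submonoid R)

lemma locMap_comp (f : X →ₗ[R] Y) (g : Y →ₗ[R] Z) :
    LocalizedModule.map S (g ∘ₗ f) = LocalizedModule.map S g ∘ₗ LocalizedModule.map S f := by
  apply LinearMap.ext
  intro x
  induction x using LocalizedModule.induction_on with
  | h x s => simp only [LinearMap.comp_apply, LocalizedModule.map_mk]

lemma locMap_id : LocalizedModule.map S (LinearMap.id : X →ₗ[R] X) = LinearMap.id := by
  apply LinearMap.ext
  intro x
  induction x using LocalizedModule.induction_on with
  | h x s => simp only [LinearMap.id_apply, LocalizedModule.map_mk]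

lemma IsSES.loc {f : A →ₗ[R] B} {g : B →ₗ[R] D} (h : IsSES f g) :
    IsSES (LocalizedModule.map S f) (LocalizedModule.map S g) :=
  ⟨LocalizedModule.map_injective S f h.inj, LocalizedModule.map_exact S f g h.exact,
    LocalizedModule.map_surjective S g h.surj⟩

lemma exists_locMap_eq_smul [Module.FinitePresentation R X]
    (φ : LocalizedModule S X →ₗ[Localization S] LocalizedModule S Y) :
    ∃ (s : S) (ψ : X →ₗ[R] Y), LocalizedModule.map S ψ = (s : R) • φ := by
  obtain ⟨⟨ψ, s⟩, h⟩ := IsLocalizedModule.surj S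
    (LocalizedModule.map S : (X →ₗ[R] Y) →ₗ[R]
      (LocalizedModule S X →ₗ[Localization S] LocalizedModule S Y)) φ
  exact ⟨s, ψ, h.symm⟩

lemma exists_eq_smul_locMap [Module.FinitePresentation R X]
    (φ : LocalizedModule S X →ₗ[Localization S] LocalizedModule S Y) :
    ∃ (a : Localization S) (ψ : X →ₗ[R] Y), φ = a • LocalizedModule.map S ψ := by
  obtain ⟨s, ψ, h⟩ := exists_locMap_eq_smul S φ
  refine ⟨Localization.mk 1 s, ψ, ?_⟩
  rw [h, ← algebraMap_smul (Localization S) (s : R) φ, smul_smul,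
    ← Localization.mk_one_eq_algebraMap, Localization.mk_mul, one_mul, mul_one,
    Localization.mk_self, one_smul]

lemma extVanish_loc [IsNoetherianRing R] (i : ℕ) :
    ∀ (X : Type u) [AddCommGroup X] [Module R X] [Module.Finite R X], ExtVanish R X Y i →
      ExtVanish (Localization S) (LocalizedModule S X) (LocalizedModule S Y) i := by
  match i with
  | 0 =>
    intro X _ _ _ h
    have := Module.finitePresentation_of_finite R X
    rw [extVanish_zero_iff] at h ⊢
    intro φ
    obtain ⟨a, ψ, rfl⟩ := exists_eq_smul_locMap S φ
    rw [h ψ, map_zero, smul_zero]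
  | 1 =>
    intro X _ _ _ h
    obtain ⟨b, p, hp⟩ := Module.Finite.exists_fin' R X
    have hs := IsSES.kerSubtype hp
    have := Module.finitePresentation_of_finite R (LinearMap.ker p)
    have : Module.Projective (Localization S) (LocalizedModule S (Fin b → R)) := inferInstance
    refine (hs.loc S).con_of_exists_ext (extVanish_of_projective 0) fun φ => ?_
    obtain ⟨a, ψ, rfl⟩ := exists_eq_smul_locMap S φ
    obtain ⟨χ, rfl⟩ := hs.exists_ext h ψ
    exact ⟨a • LocalizedModule.map S χ, by rw [locMap_comp, LinearMap.smul_comp]⟩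
  | i + 2 =>
    intro X _ _ _ h
    obtain ⟨b, p, hp⟩ := Module.Finite.exists_fin' R X
    have hs := IsSES.kerSubtype hp
    have : Module.Projective (Localization S) (LocalizedModule S (Fin b → R)) := inferInstance
    exact ((hs.loc S).con_proj_iff i).2 (extVanish_loc (i + 1) _ ((hs.con_proj_iff i).1 h))

lemma SemiDual.loc [IsNoetherianRing R] (h : SemiDual R C) :
    SemiDual (Localization S) (LocalizedModule S C) := by
  have := h.finite
  have := Module.finitePresentation_of_finite R C
  refine ⟨inferInstance, ⟨?_, fun φ => ?_⟩, fun i => extVanish_loc S (i + 1) C (h.ext i)⟩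
  · rw [injective_iff_map_eq_zero]
    intro a ha
    obtain ⟨⟨r, s⟩, hrs⟩ := IsLocalization.surj S a
    simp only at hrs
    have h1 : (LocalizedModule.map S (LinearMap.lsmul R C r) :
        LocalizedModule S C →ₗ[Localization S] LocalizedModule S C) = 0 := by
      have h2 : LinearMap.lsmul R C r = r • LinearMap.id := rfl
      rw [h2, map_smul, locMap_id]
      apply LinearMap.ext
      intro x
      have h3 : a • x = 0 := LinearMap.congr_fun ha x
      rw [LinearMap.smul_apply, LinearMap.id_apply, ← algebraMap_smul (Localization S) r x, ← hrs,
        mul_comm, mul_smul, h3, smul_zero, LinearMap.zero_apply]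
    obtain ⟨t, ht⟩ := (IsLocalizedModule.eq_zero_iff S (LocalizedModule.map S : (C →ₗ[R] C) →ₗ[R]
      (LocalizedModule S C →ₗ[Localization S] LocalizedModule S C))).1 h1
    have h3 : (t : R) * r = 0 := h.eq_zero_of_smul _ fun c => by
      rw [mul_smul]
      exact LinearMap.congr_fun ht c
    rw [(IsLocalization.map_eq_zero_iff S (Localization S) r).2 ⟨t, h3⟩] at hrs
    exact ((IsLocalization.map_units (Localization S) s).mul_left_eq_zero).1 hrs
  · obtain ⟨a, ψ, rfl⟩ := exists_eq_smul_locMap S φ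
    obtain ⟨r, rfl⟩ := h.bij.2 ψ
    refine ⟨a * Localization.mk r 1, ?_⟩
    apply LinearMap.ext
    intro x
    induction x using LocalizedModule.induction_on with
    | h c t => simp [mul_smul, LocalizedModule.mk_smul_mk]

lemma AddC.loc (h : AddC R C D) : AddC (Localization S) (LocalizedModule S C)
    (LocalizedModule S D) := by
  obtain ⟨I, s, r, hrs⟩ := h
  let f : (I →₀ C) →ₗ[R] (I →₀ LocalizedModule S C) :=
    Finsupp.mapRange.linearMap (LocalizedModule.mkLinearMap S C)
  let e := IsLocalizedModule.iso S f
  let e' : LocalizedModule S (I →₀ C) ≃ₗ[Localization S] (I →₀ LocalizedModule S C) :=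
    LinearEquiv.extendScalarsOfIsLocalization S (Localization S) e
  refine ⟨I, e'.toLinearMap ∘ₗ LocalizedModule.map S s,
    LocalizedModule.map S r ∘ₗ e'.symm.toLinearMap, ?_⟩
  rw [LinearMap.comp_assoc, ← LinearMap.comp_assoc _ _ e'.symm.toLinearMap]
  simp [← locMap_comp, hrs]

lemma CSyz.loc {n : ℕ} {V : ModuleCat.{u} R} (h : CSyz R C n V) :
    CSyz (Localization S) (LocalizedModule S C) n
      (ModuleCat.of (Localization S) (LocalizedModule S V)) := by
  induction n generalizing V with
  | zero => trivial
  | succ n ih =>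
    obtain ⟨D, W, f, g, hD, hfg, hW⟩ := h
    exact ⟨ModuleCat.of _ (LocalizedModule S D), ModuleCat.of _ (LocalizedModule S W),
      LocalizedModule.map S f, LocalizedModule.map S g, hD.loc S, hfg.loc S, ih hW⟩

end Localization

lemma addC_tensor (P : Type u) [AddCommGroup P] [Module R P] [Module.Projective R P] :
    AddC R C (TensorProduct R P C) := by
  obtain ⟨s, hs⟩ := Module.projective_def'.1 ‹Module.Projective R P›
  classical
  let e : TensorProduct R (P →₀ R) C ≃ₗ[R] (P →₀ C) :=
    TensorProduct.finsuppLeft R R R C P ≪≫ₗ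
      Finsupp.mapRange.linearEquiv (TensorProduct.lid R C)
  refine ⟨P, e.toLinearMap ∘ₗ LinearMap.rTensor C s,
    LinearMap.rTensor C (Finsupp.linearCombination R id) ∘ₗ e.symm.toLinearMap, ?_⟩
  rw [LinearMap.comp_assoc, ← LinearMap.comp_assoc _ _ e.symm.toLinearMap]
  simp [← LinearMap.rTensor_comp, hs]

lemma CSyz.of_isNthCSyzygyAux {n : ℕ} {V : ModuleCat.{u} R}
    (h : Paper.IsNthCSyzygyAux R C n V) : CSyz R C n V := by
  induction n generalizing V with
  | zero => trivial
  | succ n ih =>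
    obtain ⟨P, hP, f, hf, hW⟩ := h
    exact ⟨ModuleCat.of R (TensorProduct R P C), _, f, (LinearMap.range f).mkQ, addC_tensor P,
      IsSES.rangeMkQ hf, ih hW⟩

end

section

variable {R : Type u} [CommRing R]
variable {A B D X Y Z C M T S : Type u} [AddCommGroup A] [AddCommGroup B] [AddCommGroup D]
  [AddCommGroup X] [AddCommGroup Y] [AddCommGroup Z] [AddCommGroup C] [AddCommGroup M]
  [Module R A] [Module R B] [Module R D] [Module R X] [Module R Y] [Module R Z] [Module R C]
  [Module R M] [AddCommGroup T] [Module R T] [AddCommGroup S] [Module R S]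

lemma ExtVanish.dual_of_acyclic [IsNoetherianRing R] {t : ℕ} (hX : ∀ i < t, ExtVanish R X C i)
    (i : ℕ) (hi : i < t) :
    ∀ (T : Type u) [AddCommGroup T] [Module R T] [Module.Finite R T],
      (∀ i, ExtVanish R T C (i + 1)) → ExtVanish R X (T →ₗ[R] C) i := by
  induction i with
  | zero =>
    intro T _ _ _ hT
    obtain ⟨b, p, hp⟩ := Module.Finite.exists_fin' R T
    have h0 := (hX 0 hi).homProjective (Fin b → R)
    rw [extVanish_zero_iff] at h0 ⊢
    intro φ
    ext x : 1
    exact (IsSES.kerSubtype hp).lcomp_injective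
      (LinearMap.congr_fun (h0 (LinearMap.lcomp R C p ∘ₗ φ)) x)
  | succ i ih =>
    intro T _ _ _ hT
    obtain ⟨b, p, hp⟩ := Module.Finite.exists_fin' R T
    have hs := IsSES.kerSubtype hp
    exact (hs.dual (hT 0)).cov_left (ih (by omega) _ fun j => (hs.con_proj_iff j).1 (hT (j + 1)))
      ((hX (i + 1) hi).homProjective (Fin b → R))

lemma push_dual_injective [IsNoetherianRing R] [Module.Finite R T] {t : ℕ}
    (hX : ∀ i < t, ExtVanish R X C i) (hT : ∀ i, ExtVanish R T C (i + 1)) {b : ℕ}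
    {p : (Fin b → R) →ₗ[R] T} (hp : Function.Surjective p) :
    Function.Injective (push X (LinearMap.lcomp R C p) t) := by
  have hs := IsSES.kerSubtype hp
  refine (hs.dual (hT 0)).push_injective fun j hj => ?_
  exact ExtVanish.dual_of_acyclic hX j (by omega) _ fun j => (hs.con_proj_iff j).1 (hT (j + 1))

section Local

variable [IsLocalRing R] [IsNoetherianRing R]

theorem surjective_of_push_dual_injective [Module.Finite R S] [Module.Finite R T]
    {d : ℕ} (hC : ∀ i < d, ExtVanish R (R ⧸ IsLocalRing.maximalIdeal R) C i)
    (hCd : ¬ ExtVanish R (R ⧸ IsLocalRing.maximalIdeal R) C d)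
    (hS : ∀ i, ExtVanish R S C (i + 1)) (hT : ∀ i, ExtVanish R T C (i + 1)) (φ : S →ₗ[R] T)
    (hφ : Function.Injective (push (R ⧸ IsLocalRing.maximalIdeal R) (LinearMap.lcomp R C φ) d)) :
    Function.Surjective φ := by
  set k := R ⧸ IsLocalRing.maximalIdeal R
  rw [← LinearMap.range_eq_top]
  by_contra hne
  obtain ⟨N, hN, hle⟩ := (eq_top_or_exists_le_coatom (LinearMap.range φ)).resolve_left hne
  obtain ⟨t₀, ht₀⟩ : ∃ t, t ∉ N := by
    by_contra! h
    exact hN.1 (Submodule.eq_top_iff'.2 h)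
  obtain ⟨b, p, hp⟩ := Module.Finite.exists_fin' R N
  let q : (R × (Fin b → R)) →ₗ[R] T :=
    (LinearMap.toSpanSingleton R T t₀).coprod (N.subtype ∘ₗ p)
  have hq : Function.Surjective q := by
    rw [← LinearMap.range_eq_top, LinearMap.range_coprod]
    have hN' : LinearMap.range (N.subtype ∘ₗ p) = N := by
      rw [LinearMap.range_comp, LinearMap.range_eq_top.2 hp, Submodule.map_subtype_top]
    rw [hN']
    refine hN.2 _ (lt_of_le_of_ne le_sup_right fun h => ht₀ ?_)
    rw [h]
    exact Submodule.mem_sup_left ⟨1, one_smul R t₀⟩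
  have hfst : ∀ x ∈ LinearMap.ker q, x.1 ∈ IsLocalRing.maximalIdeal R := by
    intro x hx
    by_contra hu
    obtain ⟨u, hu⟩ := IsLocalRing.notMem_maximalIdeal.1 hu
    have hx0 : x.1 • t₀ + (p x.2 : T) = 0 := hx
    have hxN : x.1 • t₀ ∈ N := by
      rw [eq_neg_of_add_eq_zero_left hx0]
      exact N.neg_mem (p x.2).2
    rw [← hu] at hxN
    exact ht₀ ((Submodule.smul_mem_iff_of_isUnit N u.isUnit).1 hxN)
  have hs := IsSES.kerSubtype hq
  have hd := hs.dual (hT 0)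
  obtain ⟨v, hv⟩ : ∃ v : DExt R k C d, v ≠ 0 := by
    by_contra! h
    exact hCd (extVanish_iff.2 h)
  let j : C →ₗ[R] ((R × (Fin b → R)) →ₗ[R] C) :=
    (LinearMap.lsmul R C ∘ₗ LinearMap.fst R R (Fin b → R)).flip
  have hw : push k j d v ≠ 0 := by
    intro h0
    apply hv
    have hr : LinearMap.applyₗ ((1 : R), (0 : Fin b → R)) ∘ₗ j = LinearMap.id := by
      ext c
      simp [j]
    rw [← push_id d v, ← hr, push_comp, h0, push_zero]
  have h1 : push k (LinearMap.lcomp R C (LinearMap.ker q).subtype) d (push k j d v) = 0 := by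
    obtain ⟨e, π, hπ⟩ := Module.Finite.exists_fin' R (LinearMap.ker q)
    apply push_dual_injective hC (fun j => (hs.con_proj_iff j).1 (hT (j + 1))) hπ
    rw [push_zero, ← push_comp, ← push_comp, LinearMap.comp_assoc]
    have h2 : LinearMap.lcomp R C π ∘ₗ LinearMap.lcomp R C (LinearMap.ker q).subtype ∘ₗ j =
        ∑ l, (π (Pi.single l 1)).1.1 •
          (LinearMap.lsmul R C ∘ₗ (LinearMap.proj l : (Fin e → R) →ₗ[R] R)).flip := by
      ext c l
      simp [j, Pi.single_apply]
    rw [h2, push_sum_map]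
    refine Finset.sum_eq_zero fun l _ => ?_
    rw [push_smul_map]
    refine smul_ext_eq_zero _ (fun x => ?_) _ _
    obtain ⟨y, rfl⟩ := Ideal.Quotient.mk_surjective x
    rw [← Ideal.Quotient.mkₐ_eq_mk R, ← map_smul, Ideal.Quotient.mkₐ_eq_mk,
      Ideal.Quotient.eq_zero_iff_mem]
    exact Ideal.mul_mem_right _ _ (hfst _ (π _).2)
  obtain ⟨v', hv'⟩ := hd.exists_push_eq _ h1
  have hv'0 : v' = 0 := by
    apply hφ
    obtain ⟨c, σ, hσ⟩ := Module.Finite.exists_fin' R S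
    apply push_dual_injective hC hS hσ
    obtain ⟨l, hl⟩ := Module.projective_lifting_property p
      ((φ ∘ₗ σ).codRestrict N fun x => hle ⟨σ x, rfl⟩) hp
    have h3 : φ ∘ₗ σ = q ∘ₗ LinearMap.inr R R (Fin b → R) ∘ₗ l := by
      ext x
      have := congrArg N.subtype (LinearMap.congr_fun hl (Pi.single x 1))
      simpa [q] using this.symm
    have h4 : LinearMap.lcomp R C σ ∘ₗ LinearMap.lcomp R C φ =
        LinearMap.lcomp R C (LinearMap.inr R R (Fin b → R) ∘ₗ l) ∘ₗ LinearMap.lcomp R C q := by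
      ext f x
      simpa using congrArg f (LinearMap.congr_fun h3 (Pi.single x 1))
    have h5 : LinearMap.lcomp R C (LinearMap.inr R R (Fin b → R) ∘ₗ l) ∘ₗ j = 0 := by
      ext c x
      simp [j]
    rw [push_zero, push_zero, ← push_comp, h4, push_comp, hv', ← push_comp, h5, push_zero_map]
  exact hw (by rw [← hv', hv'0, push_zero])

end Local

end

section

variable {R : Type u} [CommRing R]
variable {A B D X Y Z C M G K : Type u} [AddCommGroup A] [AddCommGroup B] [AddCommGroup D]
  [AddCommGroup X] [AddCommGroup Y] [AddCommGroup Z] [AddCommGroup C] [AddCommGroup M]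
  [Module R A] [Module R B] [Module R D] [Module R X] [Module R Y] [Module R Z] [Module R C]
  [Module R M] [AddCommGroup G] [Module R G] [AddCommGroup K] [Module R K]

lemma SemiDual.extVanish_ring [IsNoetherianRing R] (h : SemiDual R C) {t : ℕ}
    (hC : ∀ i < t, ExtVanish R X C i) (i : ℕ) (hi : i < t) : ExtVanish R X R i := by
  have := h.finite
  exact (ExtVanish.dual_of_acyclic hC i hi C h.ext).congr_right h.homothety.symm

lemma SemiDual.not_extVanish_ring [IsLocalRing R] [IsNoetherianRing R] (h : SemiDual R C) {d : ℕ}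
    (hC : ∀ i < d, ExtVanish R (R ⧸ IsLocalRing.maximalIdeal R) C i)
    (hCd : ¬ ExtVanish R (R ⧸ IsLocalRing.maximalIdeal R) C d) :
    ¬ ExtVanish R (R ⧸ IsLocalRing.maximalIdeal R) R d := by
  intro hR
  have := h.finite
  have hR' := hR.congr_right h.homothety
  have hs := surjective_of_push_dual_injective hC hCd
    (extVanish_of_projective (X := Fin 0 → R)) h.ext 0
    fun a b _ => by rw [hR'.eq_zero a, hR'.eq_zero b]
  refine one_ne_zero (h.eq_zero_of_smul (1 : R) fun c => ?_)
  obtain ⟨x, rfl⟩ := hs c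
  simp

/-- A finitely generated `C`-reflexive module whose dual has no higher extensions by `C`. -/
structure GZ (R C M : Type u) [CommRing R] [AddCommGroup C] [Module R C]
    [AddCommGroup M] [Module R M] : Prop where
  finite : Module.Finite R M
  bij : Function.Bijective (Paper.bidualityMap R C M)
  ext : ∀ i : ℕ, ExtVanish R (M →ₗ[R] C) C (i + 1)

lemma _root_.Paper.GCdimZero.gz (h : Paper.GCdimZero R C M) : GZ R C M :=
  ⟨h.1, h.2.1, fun i => (extGrp_iff (M →ₗ[R] C) C (i + 1)).1 (h.2.2.2 (i + 1) i.succ_pos)⟩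

lemma GZ.of_subsingleton [Subsingleton M] : GZ R C M := by
  have : Subsingleton (M →ₗ[R] C) := ⟨fun a b => by ext x; rw [Subsingleton.elim x 0]; simp⟩
  exact ⟨inferInstance, ⟨fun a b _ => Subsingleton.elim a b,
    fun Φ => ⟨0, by ext φ; rw [Subsingleton.elim φ 0]; simp⟩⟩,
    fun i => extVanish_of_subsingleton_left (i + 1)⟩

lemma GZ.torsionless (h : GZ R C M) : Torsionless R C M := fun x hx => by
  apply h.bij.1
  ext φ
  simpa [Paper.bidualityMap] using hx φ

/-- The cokernel of a monomorphism of `GZ` modules with surjective dual. -/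
lemma GZ.of_ses {ι : K →ₗ[R] G} {g : G →ₗ[R] M} (h : IsSES ι g) (hK : GZ R C K) (hG : GZ R C G)
    (hs : Function.Surjective (LinearMap.lcomp R C ι)) : GZ R C M := by
  have h1 := h.dual_of_surjective hs
  have h2 := h1.dual (hK.ext 0)
  have := hG.finite
  refine ⟨Module.Finite.of_surjective g h.surj, ⟨?_, ?_⟩,
    fun i => h1.con_left (hG.ext i) (hK.ext (i + 1))⟩
  · rw [injective_iff_map_eq_zero]
    intro m hm
    obtain ⟨x, rfl⟩ := h.surj m
    obtain ⟨Φ, hΦ⟩ := (h2.exact (Paper.bidualityMap R C G x)).1 hm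
    obtain ⟨y, rfl⟩ := hK.bij.2 Φ
    have : ι y = x := hG.bij.1 hΦ
    rw [← this, h.apply_apply]
  · intro Φ
    obtain ⟨Ψ, rfl⟩ := h2.surj Φ
    obtain ⟨x, rfl⟩ := hG.bij.2 Ψ
    exact ⟨g x, rfl⟩

lemma SemiDual.gz_finFun [IsNoetherianRing R] (h : SemiDual R C) (b : ℕ) : GZ R C (Fin b → C) := by
  have := h.finite
  have := h.projective_dual b
  refine ⟨inferInstance, ⟨?_, fun Φ => ?_⟩, fun i => extVanish_of_projective i⟩
  · rw [injective_iff_map_eq_zero]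
    intro x hx
    ext j
    exact LinearMap.congr_fun hx (LinearMap.proj j)
  · refine ⟨fun j => Φ (LinearMap.proj j), ?_⟩
    apply LinearMap.ext
    intro ψ
    obtain ⟨c, rfl⟩ := exists_eq_sum_proj h ψ
    simp [Paper.bidualityMap]

lemma GZ.extVanish [IsNoetherianRing R] [Module.Finite R C] (h : GZ R C M)
    {t : ℕ} (hX : ∀ i < t, ExtVanish R X C i) (i : ℕ) (hi : i < t) : ExtVanish R X M i := by
  have := h.finite
  exact (ExtVanish.dual_of_acyclic hX i hi _ h.ext).congr_right
    (LinearEquiv.ofBijective _ h.bij).symm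

section AuslanderBuchsbaum

variable [IsLocalRing R] [IsNoetherianRing R]

lemma GZ.of_depth [Module.Finite R C] {ι : K →ₗ[R] G} {g : G →ₗ[R] M} (h : IsSES ι g)
    (hK : GZ R C K) (hG : GZ R C G) {d : ℕ}
    (hC : ∀ i < d, ExtVanish R (R ⧸ IsLocalRing.maximalIdeal R) C i)
    (hCd : ¬ ExtVanish R (R ⧸ IsLocalRing.maximalIdeal R) C d)
    (hM : ∀ i < d, ExtVanish R (R ⧸ IsLocalRing.maximalIdeal R) M i) : GZ R C M := by
  have := hK.finite
  have := hG.finite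
  refine GZ.of_ses h hK hG (surjective_of_push_dual_injective hC hCd hG.ext hK.ext _ ?_)
  let eK := LinearEquiv.ofBijective _ hK.bij
  let eG := LinearEquiv.ofBijective _ hG.bij
  have h1 := h.push_injective (X := R ⧸ IsLocalRing.maximalIdeal R) (i := d)
    fun j hj => hM j (by omega)
  have h2 : eG.symm.toLinearMap ∘ₗ LinearMap.lcomp R C (LinearMap.lcomp R C ι) =
      ι ∘ₗ eK.symm.toLinearMap := by
    apply LinearMap.ext
    intro Φ
    obtain ⟨y, rfl⟩ := eK.surjective Φ
    simp only [LinearMap.comp_apply, LinearEquiv.coe_coe, LinearEquiv.symm_apply_apply]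
    rw [LinearEquiv.symm_apply_eq]
    rfl
  intro a b hab
  have h3 := congrArg (push _ eG.symm.toLinearMap d) hab
  rw [← push_comp, ← push_comp, h2, push_comp, push_comp] at h3
  have h4 := congrArg (push _ eK.toLinearMap d) (h1 h3)
  rwa [← push_comp, ← push_comp, LinearEquiv.comp_coe, LinearEquiv.symm_trans_self,
    LinearEquiv.refl_toLinearMap, push_id, push_id] at h4

theorem gz_of_gCdimLE [Module.Finite R C] {d : ℕ}
    (hC : ∀ i < d, ExtVanish R (R ⧸ IsLocalRing.maximalIdeal R) C i)
    (hCd : ¬ ExtVanish R (R ⧸ IsLocalRing.maximalIdeal R) C d) (n : ℕ) :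
    ∀ (M : Type u) [AddCommGroup M] [Module R M],
      (∀ i < d, ExtVanish R (R ⧸ IsLocalRing.maximalIdeal R) M i) →
      Paper.GCdimLE R C M n → GZ R C M := by
  induction n with
  | zero =>
    rintro M _ _ hM ⟨G, δ, ε, hε, h0, h1, hG, hn⟩
    have h := IsSES.kerSubtype hε
    have : Subsingleton (LinearMap.ker ε) := by
      rw [← h0]
      have := hn 1 one_pos
      exact ⟨by rintro ⟨_, x, rfl⟩ ⟨_, y, rfl⟩; simp [Subsingleton.elim x y]⟩
    exact GZ.of_depth h .of_subsingleton (hG 0).gz hC hCd hM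
  | succ n ih =>
    rintro M _ _ hM ⟨G, δ, ε, hε, h0, h1, hG, hn⟩
    have h := IsSES.kerSubtype hε
    refine GZ.of_depth h (ih _ ?_ ?_) (hG 0).gz hC hCd hM
    · rintro (_ | i) hi
      · rw [extVanish_zero_iff]
        have := extVanish_zero_iff.1 ((hG 0).gz.extVanish hC 0 hi)
        intro φ
        refine LinearMap.ext fun x => Subtype.ext ?_
        exact LinearMap.congr_fun (this ((LinearMap.ker ε).subtype ∘ₗ φ)) x
      · exact h.cov_left (hM i (by omega)) ((hG 0).gz.extVanish hC (i + 1) hi)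
    · refine ⟨fun i => G (i + 1), fun i => δ (i + 1),
        (δ 0).codRestrict (LinearMap.ker ε) fun x => h0 ▸ ⟨x, rfl⟩, ?_, ?_, fun i => h1 (i + 1),
        fun i => hG (i + 1), fun i hi => hn (i + 1) (by omega)⟩
      · rintro ⟨x, hx⟩
        obtain ⟨y, rfl⟩ := h0.symm ▸ hx
        exact ⟨y, rfl⟩
      · rw [LinearMap.ker_codRestrict]
        exact h1 0

end AuslanderBuchsbaum

end

section

variable {R : Type u} [CommRing R]
variable {A B D X Y Z C M G K : Type u} [AddCommGroup A] [AddCommGroup B] [AddCommGroup D]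
  [AddCommGroup X] [AddCommGroup Y] [AddCommGroup Z] [AddCommGroup C] [AddCommGroup M]
  [Module R A] [Module R B] [Module R D] [Module R X] [Module R Y] [Module R Z] [Module R C]
  [Module R M] [AddCommGroup G] [Module R G] [AddCommGroup K] [Module R K]

lemma le_edepth_iff (I : Ideal R) (a : ℕ∞) :
    a ≤ Paper.edepth R I M ↔ ∀ i : ℕ, (i : ℕ∞) < a → ExtVanish R (R ⧸ I) M i := by
  rw [Paper.edepth, le_sInf_iff]
  constructor
  · intro h i hi
    rw [← extGrp_iff, ← not_nontrivial_iff_subsingleton]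
    exact fun hn => absurd (h i ⟨i, rfl, hn⟩) (not_le.2 hi)
  · rintro h _ ⟨i, rfl, hn⟩
    by_contra hi
    rw [← not_subsingleton_iff_nontrivial, extGrp_iff] at hn
    exact hn (h i (not_le.1 hi))

lemma edepth_le {I : Ideal R} {i : ℕ} (h : ¬ ExtVanish R (R ⧸ I) M i) :
    Paper.edepth R I M ≤ i := by
  by_contra hi
  exact h ((le_edepth_iff I _).1 le_rfl i (not_le.1 hi))

lemma AddC.punit : AddC R C PUnit.{u + 1} :=
  ⟨PUnit, 0, 0, Subsingleton.elim _ _⟩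

lemma CSyz.of_subsingleton (n : ℕ) (V : ModuleCat.{u} R) [Subsingleton V] : CSyz R C n V := by
  induction n with
  | zero => trivial
  | succ n ih =>
    refine ⟨ModuleCat.of R PUnit, V, 0, 0, AddC.punit, ⟨?_, ?_, ?_⟩, ih⟩
    · exact fun a b _ => Subsingleton.elim a b
    · exact fun x => ⟨fun _ => ⟨0, Subsingleton.elim _ _⟩, fun _ => Subsingleton.elim _ _⟩
    · exact fun x => ⟨0, Subsingleton.elim _ _⟩

section Local

variable [IsLocalRing R]

lemma SemiDual.extVanish_of_ring [IsNoetherianRing R] (h : SemiDual R C) {t : ℕ}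
    (hR : ∀ i < t, ExtVanish R (R ⧸ IsLocalRing.maximalIdeal R) R i) (i : ℕ) (hi : i < t) :
    ExtVanish R (R ⧸ IsLocalRing.maximalIdeal R) C i := by
  induction i using Nat.strong_induction_on with
  | _ i ih =>
    by_contra hC
    exact h.not_extVanish_ring (fun j hj => ih j hj (hj.trans hi)) hC (hR i hi)

/-- The socle of `M` is torsionless with respect to `C`. -/
def SocleTorsionless (R C M : Type u) [CommRing R] [IsLocalRing R] [AddCommGroup C] [Module R C]
    [AddCommGroup M] [Module R M] : Prop :=
  ∀ x : M, (∀ r ∈ IsLocalRing.maximalIdeal R, r • x = 0) → (∀ φ : M →ₗ[R] C, φ x = 0) → x = 0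

/-- Up to adding a summand of copies of `C`, the module `M` is an extension of a `j`-th
`C`-syzygy by a module of depth at least `j`. -/
def DepthSyz (R C : Type u) [CommRing R] [IsLocalRing R] [AddCommGroup C] [Module R C] (j : ℕ)
    (M : Type u) [AddCommGroup M] [Module R M] : Prop :=
  (∀ i, i + 1 < j → ExtVanish R (R ⧸ IsLocalRing.maximalIdeal R) C i) ∧
  ∃ (U D W : ModuleCat.{u} R) (f : U →ₗ[R] (M × D)) (g : (M × D) →ₗ[R] W),
    AddC R C D ∧ IsSES f g ∧ CSyz R C j W ∧
      ∀ i < j, ExtVanish R (R ⧸ IsLocalRing.maximalIdeal R) U i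

lemma CSyz.depthSyz {j : ℕ} (hM : CSyz R C j (ModuleCat.of R M))
    (hC : ∀ i, i + 1 < j → ExtVanish R (R ⧸ IsLocalRing.maximalIdeal R) C i) :
    DepthSyz R C j M := by
  refine ⟨hC, ModuleCat.of R PUnit, ModuleCat.of R PUnit, ModuleCat.of R M, 0,
    LinearMap.fst R M PUnit.{u + 1}, AddC.punit, ⟨?_, ?_, LinearMap.fst_surjective⟩, hM,
    fun i _ => extVanish_of_subsingleton_right i⟩
  · exact fun a b _ => Subsingleton.elim a b
  · rintro ⟨x, y⟩
    constructor
    · rintro (rfl : x = 0)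
      exact ⟨0, rfl⟩
    · rintro ⟨z, hz⟩
      rw [← hz]
      rfl

lemma depthSyz_of_extVanish {j : ℕ}
    (hM : ∀ i < j, ExtVanish R (R ⧸ IsLocalRing.maximalIdeal R) M i)
    (hC : ∀ i, i + 1 < j → ExtVanish R (R ⧸ IsLocalRing.maximalIdeal R) C i) :
    DepthSyz R C j M := by
  refine ⟨hC, ModuleCat.of R M, ModuleCat.of R PUnit, ModuleCat.of R PUnit,
    LinearMap.inl R M PUnit.{u + 1}, 0, AddC.punit, ⟨LinearMap.inl_injective, ?_, ?_⟩,
    CSyz.of_subsingleton j _, hM⟩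
  · rintro ⟨x, y⟩
    exact ⟨fun _ => ⟨x, rfl⟩, fun _ => rfl⟩
  · exact fun x => ⟨0, Subsingleton.elim _ _⟩

lemma DepthSyz.socleTorsionless {j : ℕ} (h : DepthSyz R C (j + 1) M) :
    SocleTorsionless R C M := by
  obtain ⟨-, U, D, W, f, g, hD, hfg, ⟨D', W', f', g', hD', hfg', -⟩, hU⟩ := h
  intro x hx hφ
  have h1 : g (x, 0) = 0 := by
    apply hfg'.inj
    rw [map_zero]
    exact hD'.torsionless _ fun ψ => hφ (ψ ∘ₗ f' ∘ₗ g ∘ₗ LinearMap.inl R M D)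
  obtain ⟨y, hy⟩ := (hfg.exact _).1 h1
  have hmy : ∀ r ∈ IsLocalRing.maximalIdeal R, r • y = 0 := by
    intro r hr
    apply hfg.inj
    rw [map_smul, hy, map_zero, Prod.smul_mk, hx r hr, smul_zero]
    rfl
  let θ : (R ⧸ IsLocalRing.maximalIdeal R) →ₗ[R] U :=
    (IsLocalRing.maximalIdeal R).liftQ (LinearMap.toSpanSingleton R U y) hmy
  have hθ : θ = 0 := extVanish_zero_iff.1 (hU 0 j.succ_pos) θ
  have hy0 : y = 0 := by
    have : θ (Submodule.Quotient.mk 1) = y := one_smul R y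
    rw [← this, hθ, LinearMap.zero_apply]
  rw [hy0, map_zero] at hy
  exact (congrArg Prod.fst hy).symm

theorem DepthSyz.pushforward [IsNoetherianRing R] [Module.Finite R M] {j b : ℕ}
    (h : DepthSyz R C (j + 1) M)
    {α : M →ₗ[R] (Fin b → C)} {π : (Fin b → C) →ₗ[R] K} (hα : IsUniversal α) (hs : IsSES α π) :
    DepthSyz R C j K := by
  obtain ⟨hC, U, D, W, f, g, hD, hfg, ⟨D', W', f', g', hD', hfg', hW'⟩, hU⟩ := h
  obtain ⟨χ, hχ⟩ := exists_extension_addC hD' (ι := α) (fun φ => hα φ)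
    (f' ∘ₗ g ∘ₗ LinearMap.inl R M D)
  replace hχ : ∀ m, χ (α m) = f' (g (m, 0)) := fun m => LinearMap.congr_fun hχ m
  let E : ((Fin b → C) × D) →ₗ[R] (K × D') :=
    (π ∘ₗ LinearMap.fst R (Fin b → C) D).prod
      (χ.coprod (f' ∘ₗ g ∘ₗ LinearMap.inr R M D))
  have hE : ∀ m d, E (α m, d) = (0, f' (g (m, d))) := by
    intro m d
    refine Prod.ext (hs.apply_apply m) ?_
    change χ (α m) + f' (g (0, d)) = f' (g (m, d))
    rw [hχ, ← map_add, ← map_add, Prod.mk_add_mk, add_zero, zero_add]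
  let F : U →ₗ[R] ((Fin b → C) × D) := (α.prodMap LinearMap.id) ∘ₗ f
  have hF : Function.Injective F :=
    (Function.Injective.prodMap hs.inj Function.injective_id).comp hfg.inj
  have hFE : Function.Exact F E := by
    rintro ⟨x, d⟩
    constructor
    · intro hx
      obtain ⟨m, rfl⟩ := (hs.exact x).1 (congrArg Prod.fst hx)
      rw [hE] at hx
      obtain ⟨y, hy⟩ := (hfg.exact (m, d)).1 (hfg'.inj ((congrArg Prod.snd hx).trans
        (map_zero f').symm))
      exact ⟨y, by simp [F, hy]⟩
    · rintro ⟨y, hy⟩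
      rw [← hy]
      change E (α (f y).1, (f y).2) = 0
      rw [hE, Prod.mk.eta, hfg.apply_apply, map_zero]
      rfl
  let E' : (((Fin b → C) × D) ⧸ LinearMap.range F) →ₗ[R] (K × D') :=
    (LinearMap.range F).liftQ E (by rintro _ ⟨y, rfl⟩; exact hFE.apply_apply_eq_zero y)
  have hE'_mk : ∀ x, E' (Submodule.Quotient.mk x) = E x := fun x => rfl
  have hE'_inj : Function.Injective E' := by
    rw [← LinearMap.ker_eq_bot, LinearMap.ker_eq_bot']
    intro x hx
    obtain ⟨x, rfl⟩ := Submodule.Quotient.mk_surjective _ x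
    exact (Submodule.Quotient.mk_eq_zero _).2 ((hFE x).1 hx)
  obtain ⟨η, hη⟩ := (hs.lcomp_exact (Y := W') (g' ∘ₗ χ)).1 (LinearMap.ext fun m => by
    change g' (χ (α m)) = 0
    rw [hχ, hfg'.apply_apply])
  replace hη : ∀ x, η (π x) = g' (χ x) := fun x => LinearMap.congr_fun hη x
  let P : (K × D') →ₗ[R] W' := (-η).coprod g'
  have hP : ∀ k d, P (k, d) = - η k + g' d := fun k d => rfl
  have hEP : Function.Exact E' P := by
    rintro ⟨k, d⟩
    constructor
    · intro hx
      obtain ⟨x, rfl⟩ := hs.surj k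
      rw [hP, hη, neg_add_eq_sub, ← map_sub] at hx
      obtain ⟨w, hw⟩ := (hfg'.exact _).1 hx
      obtain ⟨⟨m, d₀⟩, rfl⟩ := hfg.surj w
      refine ⟨Submodule.Quotient.mk ((x, 0) + (α m, d₀)), ?_⟩
      rw [hE'_mk, map_add, hE, hw]
      refine Prod.ext (add_zero _) ?_
      change χ x + f' (g (0, 0)) + (d - χ x) = d
      rw [Prod.mk_zero_zero, map_zero, map_zero, add_zero, add_sub_cancel]
    · rintro ⟨x, hx⟩
      obtain ⟨⟨x, d₀⟩, rfl⟩ := Submodule.Quotient.mk_surjective _ x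
      rw [← hx, hE'_mk]
      change - η (π x) + g' (χ x + f' (g (0, d₀))) = 0
      rw [hη, map_add, hfg'.apply_apply, add_zero, neg_add_cancel]
  have hP_surj : Function.Surjective P := by
    intro w
    obtain ⟨d, rfl⟩ := hfg'.surj w
    exact ⟨(0, d), by rw [hP, map_zero, neg_zero, zero_add]⟩
  refine ⟨fun i hi => hC i (by omega), ModuleCat.of R _, D', W', E', P, hD',
    ⟨hE'_inj, hEP, hP_surj⟩, hW', fun i hi => ?_⟩
  have hCi := hC i (by omega)
  exact (IsSES.rangeMkQ hF).cov_right ((IsSES.prod R _ D).cov_mid (hCi.finFun b)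
    (ExtVanish.addC hD i _ hCi)) (hU (i + 1) (by omega))

end Local

end

section

variable {R : Type u} [CommRing R]
variable {C M K : Type u} [AddCommGroup C] [AddCommGroup M] [Module R C] [Module R M]
  [AddCommGroup K] [Module R K]

lemma exists_finFun_loc (S : Submonoid R) {b : ℕ} {α : M →ₗ[R] (Fin b → C)}
    {π : (Fin b → C) →ₗ[R] K} [Module.FinitePresentation R M] (hα : IsUniversal α)
    (hs : IsSES α π) :
    ∃ (α' : LocalizedModule S M →ₗ[Localization S] (Fin b → LocalizedModule S C))
      (π' : (Fin b → LocalizedModule S C) →ₗ[Localization S] LocalizedModule S K),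
      IsUniversal α' ∧ IsSES α' π' := by
  let f : (Fin b → C) →ₗ[R] (Fin b → LocalizedModule S C) :=
    LinearMap.pi fun i => LocalizedModule.mkLinearMap S C ∘ₗ LinearMap.proj i
  let e : LocalizedModule S (Fin b → C) ≃ₗ[Localization S] (Fin b → LocalizedModule S C) :=
    (IsLocalizedModule.iso S f).extendScalarsOfIsLocalization S (Localization S)
  have h := hs.loc S
  refine ⟨e.toLinearMap ∘ₗ LocalizedModule.map S α, LocalizedModule.map S π ∘ₗ e.symm.toLinearMap,
    fun φ => ?_, e.injective.comp h.inj, fun x => ?_, h.surj.comp e.symm.surjective⟩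
  · obtain ⟨a, ψ, rfl⟩ := exists_eq_smul_locMap S φ
    obtain ⟨χ, rfl⟩ := hα ψ
    refine ⟨a • (LocalizedModule.map S χ ∘ₗ e.symm.toLinearMap), LinearMap.ext fun x => ?_⟩
    change a • LocalizedModule.map S χ (e.symm (e (LocalizedModule.map S α x))) =
      a • LocalizedModule.map S (χ ∘ₗ α) x
    rw [e.symm_apply_apply, locMap_comp]
    rfl
  · refine (h.exact (e.symm x)).trans ⟨?_, ?_⟩
    · rintro ⟨y, hy⟩
      exact ⟨y, by simp [hy]⟩
    · rintro ⟨y, rfl⟩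
      exact ⟨y, by simp⟩

theorem torsionless_of_socleTorsionless [IsNoetherianRing R] [Module.Finite R M]
    (h : ∀ (p : Ideal R) (_ : p.IsPrime), SocleTorsionless (Localization.AtPrime p)
      (LocalizedModule p.primeCompl C) (LocalizedModule p.primeCompl M)) :
    Torsionless R C M := by
  have := Module.finitePresentation_of_finite R M
  intro x hx
  by_contra hx0
  let N : Submodule R M := ⨅ φ : M →ₗ[R] C, LinearMap.ker φ
  have hN : ∀ y ∈ N, ∀ φ : M →ₗ[R] C, φ y = 0 := fun y hy φ => (Submodule.mem_iInf _).1 hy φ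
  have : Nontrivial N :=
    ⟨⟨x, (Submodule.mem_iInf _).2 hx⟩, 0, fun hx' => hx0 (congrArg Subtype.val hx')⟩
  obtain ⟨p, hp⟩ := associatedPrimes.nonempty R N
  obtain ⟨hprime, ⟨y, hy⟩, hpy⟩ := isAssociatedPrime_iff.1 hp
  have hann : ∀ r : R, r ∈ p ↔ r • y = 0 := by
    intro r
    rw [hpy, Submodule.mem_colon_singleton, Submodule.mem_bot, ← Subtype.coe_inj]
    rfl
  have h0 := h p hprime (LocalizedModule.mk y 1) ?_ ?_
  · obtain ⟨s, hs⟩ := (IsLocalizedModule.eq_zero_iff p.primeCompl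
      (LocalizedModule.mkLinearMap p.primeCompl M)).1 h0
    exact s.2 ((hann s).2 hs)
  · intro r hr
    induction r using Localization.induction_on with
    | H z =>
      obtain ⟨a, s⟩ := z
      rw [Localization.mk_eq_mk', IsLocalization.AtPrime.mk'_mem_maximal_iff _ p] at hr
      rw [LocalizedModule.mk_smul_mk, (hann a).1 hr, LocalizedModule.zero_mk]
  · intro φ
    obtain ⟨a, ψ, rfl⟩ := exists_eq_smul_locMap p.primeCompl φ
    rw [LinearMap.smul_apply, LocalizedModule.map_mk, hN y hy, LocalizedModule.zero_mk, smul_zero]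

/-- At every prime the module `M` is either `G_C`-projective or an almost `j`-th `C`-syzygy. -/
def LocallyGZOrSyz (C : Type u) [AddCommGroup C] [Module R C] (j : ℕ) (M : ModuleCat.{u} R) :
    Prop :=
  ∀ (p : Ideal R) (_ : p.IsPrime),
    GZ (Localization.AtPrime p) (LocalizedModule p.primeCompl C) (LocalizedModule p.primeCompl M) ∨
    DepthSyz (Localization.AtPrime p) (LocalizedModule p.primeCompl C) j
      (LocalizedModule p.primeCompl M)

theorem SemiDual.dual_of_locallyGZOrSyz [IsNoetherianRing R] [Module.Finite R M]
    (h : SemiDual R C) (n : ℕ) (hM : LocallyGZOrSyz C n (ModuleCat.of R M)) :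
    (2 ≤ n → Function.Surjective (Paper.bidualityMap R C M)) ∧
      (∀ i, i + 3 ≤ n → ExtVanish R (M →ₗ[R] C) C (i + 1)) := by
  refine pushforward_induction h (LocallyGZOrSyz C) ?_ ?_ n M hM
  · intro n M _ _ _ hM
    refine torsionless_of_socleTorsionless fun p hp => ?_
    obtain hG | hD := hM p hp
    · exact fun x _ hx => hG.torsionless x hx
    · exact hD.socleTorsionless
  · intro n M _ _ _ hM b α hα hinj p hp
    have := Module.finitePresentation_of_finite R M
    have hC := h.loc p.primeCompl
    obtain ⟨α', π', hα', hs⟩ := exists_finFun_loc p.primeCompl hα (IsSES.rangeMkQ hinj)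
    obtain hG | hD := hM p hp
    · exact Or.inl (GZ.of_ses hs hG (hC.gz_finFun b) hα')
    · exact Or.inr (hD.pushforward hα' hs)

lemma exists_least_not {P : ℕ → Prop} {n : ℕ} (h : ¬ ∀ i < n, P i) :
    ∃ d < n, (∀ i < d, P i) ∧ ¬ P d := by
  classical
  push Not at h
  have h' : ∃ i, ¬ P i := h.imp fun _ hi => hi.2
  obtain ⟨i, hi, hPi⟩ := h
  exact ⟨Nat.find h', (Nat.find_min' h' hPi).trans_lt hi,
    fun j hj => not_not.1 (Nat.find_min h' hj), Nat.find_spec h'⟩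

lemma SemiDual.ldepth_le [IsLocalRing R] [IsNoetherianRing R] (h : SemiDual R C) {d : ℕ}
    (hC : ∀ i < d, ExtVanish R (R ⧸ IsLocalRing.maximalIdeal R) C i)
    (hCd : ¬ ExtVanish R (R ⧸ IsLocalRing.maximalIdeal R) C d) : Paper.ldepth R R ≤ d :=
  edepth_le (h.not_extVanish_ring hC hCd)

lemma SemiDual.le_ldepth [IsLocalRing R] [IsNoetherianRing R] (h : SemiDual R C) {d : ℕ}
    (hC : ∀ i < d, ExtVanish R (R ⧸ IsLocalRing.maximalIdeal R) C i) :
    (d : ℕ∞) ≤ Paper.ldepth R R :=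
  (le_edepth_iff _ _).2 fun i hi => h.extVanish_ring hC i (Nat.cast_lt.1 hi)

lemma extVanish_of_serreTilde {n d : ℕ} (hM : Paper.SerreTilde R n M) (p : Ideal R) [p.IsPrime]
    (hd : d ≤ n) (hR : (d : ℕ∞) ≤ Paper.ringDepthAt R p) (i : ℕ) (hi : i < d) :
    ExtVanish (Localization.AtPrime p)
      (Localization.AtPrime p ⧸ IsLocalRing.maximalIdeal (Localization.AtPrime p))
      (LocalizedModule p.primeCompl M) i :=
  (le_edepth_iff _ _).1 ((le_min (Nat.cast_le.2 hd) hR).trans (hM p ‹_›)) i (Nat.cast_lt.2 hi)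

theorem locallyGZOrSyz_of_cSyz [IsNoetherianRing R] (h : SemiDual R C) {n : ℕ}
    (hM : CSyz R C n (ModuleCat.of R M))
    (hG : ∀ (p : Ideal R) (_ : p.IsPrime), Paper.ringDepthAt R p + 2 ≤ (n : ℕ∞) →
      Paper.GCdimFinite (Localization.AtPrime p) (LocalizedModule p.primeCompl C)
        (LocalizedModule p.primeCompl M)) :
    LocallyGZOrSyz C n (ModuleCat.of R M) := by
  intro p hp
  have hCp := h.loc p.primeCompl
  have hMp := hM.loc p.primeCompl
  by_cases hv : ∀ i < n - 1, ExtVanish (Localization.AtPrime p)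
      (Localization.AtPrime p ⧸ IsLocalRing.maximalIdeal (Localization.AtPrime p))
      (LocalizedModule p.primeCompl C) i
  · exact Or.inr (hMp.depthSyz fun i hi => hv i (by omega))
  · obtain ⟨d, hd, hvd, hnd⟩ := exists_least_not hv
    have hdepth : Paper.ringDepthAt R p + 2 ≤ (n : ℕ∞) := by
      refine (add_le_add_left (hCp.ldepth_le hvd hnd) 2).trans ?_
      exact_mod_cast (by omega : d + 2 ≤ n)
    obtain ⟨g, hg⟩ := hG p hp hdepth
    have := hCp.finite
    exact Or.inl (gz_of_gCdimLE hvd hnd g _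
      (fun i hi => hMp.extVanish hvd i (by omega) hi) hg)

theorem locallyGZOrSyz_of_serreTilde [IsNoetherianRing R] (h : SemiDual R C) {n : ℕ}
    (hM : Paper.SerreTilde R n M)
    (hG : ∀ (p : Ideal R) (_ : p.IsPrime), Paper.ringDepthAt R p + 1 ≤ (n : ℕ∞) →
      Paper.GCdimFinite (Localization.AtPrime p) (LocalizedModule p.primeCompl C)
        (LocalizedModule p.primeCompl M)) :
    LocallyGZOrSyz C n (ModuleCat.of R M) := by
  intro p hp
  have hCp := h.loc p.primeCompl
  by_cases hv : ∀ i < n, ExtVanish (Localization.AtPrime p)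
      (Localization.AtPrime p ⧸ IsLocalRing.maximalIdeal (Localization.AtPrime p))
      (LocalizedModule p.primeCompl C) i
  · exact Or.inr (depthSyz_of_extVanish
      (fun i hi => extVanish_of_serreTilde hM p le_rfl (hCp.le_ldepth hv) i hi)
      fun i hi => hv i (by omega))
  · obtain ⟨d, hd, hvd, hnd⟩ := exists_least_not hv
    have hdepth : Paper.ringDepthAt R p + 1 ≤ (n : ℕ∞) := by
      refine (add_le_add_left (hCp.ldepth_le hvd hnd) 1).trans ?_
      exact_mod_cast hd
    obtain ⟨g, hg⟩ := hG p hp hdepth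
    have := hCp.finite
    exact Or.inl (gz_of_gCdimLE hvd hnd g _
      (fun i hi => extVanish_of_serreTilde hM p hd.le (hCp.le_ldepth hvd) i hi) hg)

theorem CSyz.serreTilde [IsNoetherianRing R] (h : SemiDual R C) {n : ℕ}
    (hM : CSyz R C n (ModuleCat.of R M)) : Paper.SerreTilde R n M := by
  intro p hp
  refine (le_edepth_iff _ _).2 fun i hi => ?_
  obtain ⟨hin, hiR⟩ := lt_min_iff.1 hi
  exact (hM.loc p.primeCompl).extVanish ((h.loc p.primeCompl).extVanish_of_ring fun j hj =>
    (le_edepth_iff _ _).1 le_rfl j ((Nat.cast_le.2 (Nat.lt_succ_iff.1 hj)).trans_lt hiR)) i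
    (Nat.cast_lt.1 hin) i.lt_succ_self

end

section

variable {R : Type u} [CommRing R]
variable {C M : Type u} [AddCommGroup C] [AddCommGroup M] [Module R C] [Module R M]

lemma SemiDual.extGrp_lambda_iff [IsNoetherianRing R] [Module.Finite R M] (h : SemiDual R C)
    {N Q : Type u} [AddCommGroup N] [Module R N] [AddCommGroup Q] [Module R Q]
    (L : LinkData R C M (C →ₗ[R] N) Q) (hN : Paper.IsLambdaOf R C M N) (hB : Paper.MemBass R C M)
    (n : ℕ) :
    (∀ i, i + 1 < n → ExtVanish R (C →ₗ[R] N) C (i + 1)) ↔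
      ∀ (N' : Type u) [AddCommGroup N'] [Module R N'], Paper.IsLambdaOf R C M N' →
        ∀ i : ℕ, 0 < i → i < n → Subsingleton (Paper.ExtGrp R (C →ₗ[R] N') R i) := by
  have := h.finite
  have := finite_of_isLambdaOf hN
  have hring := h.extVanish_iff_ring (n - 1) (C →ₗ[R] N) (L.extVanish_dual h hB.1.injective
    fun i => (extGrp_iff C M (i + 1)).1 (hB.2.2 (i + 1) i.succ_pos))
  constructor
  · intro hC N' _ _ hN' i hi hin
    obtain ⟨e⟩ := isLambdaOf_unique hN' hN
    obtain ⟨i, rfl⟩ := Nat.exists_eq_succ_of_ne_zero hi.ne'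
    rw [extGrp_iff]
    exact (hring.1 (fun i hi => hC i (by omega)) i (by omega)).congr_left
      (LinearEquiv.congrRight e).symm
  · intro hR i hi
    exact hring.2 (fun i hi => (extGrp_iff _ _ _).1 (hR N hN (i + 1) i.succ_pos (by omega))) i
      (by omega)

end

end Linkage

open Paper in
/-- Theorem 4.7: for `M ∈ B_C` horizontally linked with respect
to `C`, relations between (i) vanishing of
`Ext^i_{P_C}(λ_R(C,M), C) ≅ Ext^i_R(Hom_R(C,λ_R(C,M)), R)` for `0 < i < n`,
(ii) `M` being an `n`-th `C`-syzygy, and (iii) the Serre condition `(S̃_n)`. -/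
theorem stmt_12 (R : Type u) [CommRing R] [IsNoetherianRing R]
    (hsemiperf : IsSemiperfectRing R)
    (C : Type u) [AddCommGroup C] [Module R C] (hC : IsSemidualizing R C)
    (n : ℕ) (hn : 0 < n)
    (M : Type u) [AddCommGroup M] [Module R M] [Module.Finite R M]
    (hB : MemBass R C M) (hlink : IsHorizontallyLinked R C M) :
    -- (a): (i) ⇒ (ii) and (ii) ⇒ (iii)
    ((∀ (N : Type u) [AddCommGroup N] [Module R N], IsLambdaOf R C M N →
        ∀ i : ℕ, 0 < i → i < n → Subsingleton (ExtGrp R (C →ₗ[R] N) R i)) →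
      IsNthCSyzygy R n C M) ∧
    (IsNthCSyzygy R n C M → SerreTilde R n M) ∧
    -- (b): if `M` has finite `G_C`-dimension on `X^{n-2}(R)` then (ii) ⇒ (i)
    ((∀ (p : Ideal R) (_ : p.IsPrime), ringDepthAt R p + 2 ≤ (n : ℕ∞) →
        GCdimFinite (Localization.AtPrime p) (LocalizedModule p.primeCompl C)
          (LocalizedModule p.primeCompl M)) →
      IsNthCSyzygy R n C M →
      (∀ (N : Type u) [AddCommGroup N] [Module R N], IsLambdaOf R C M N →
        ∀ i : ℕ, 0 < i → i < n → Subsingleton (ExtGrp R (C →ₗ[R] N) R i))) ∧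
    -- (c): if `M` has finite `G_C`-dimension on `X^{n-1}(R)` then (iii) ⇒ (i)
    ((∀ (p : Ideal R) (_ : p.IsPrime), ringDepthAt R p + 1 ≤ (n : ℕ∞) →
        GCdimFinite (Localization.AtPrime p) (LocalizedModule p.primeCompl C)
          (LocalizedModule p.primeCompl M)) →
      SerreTilde R n M →
      (∀ (N : Type u) [AddCommGroup N] [Module R N], IsLambdaOf R C M N →
        ∀ i : ℕ, 0 < i → i < n → Subsingleton (ExtGrp R (C →ₗ[R] N) R i))) := by
  have h := hC.semiDual
  obtain ⟨N₀, hMN, hNM⟩ := hlink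
  obtain ⟨Q, ⟨L⟩⟩ := Linkage.exists_linkData hMN hNM
  have key := h.extGrp_lambda_iff L hMN hB n
  refine ⟨fun hi => L.isNthCSyzygy n (key.2 hi), fun hi => ?_, fun hG hi => ?_, fun hG hi => ?_⟩
  · exact (Linkage.CSyz.of_isNthCSyzygyAux hi).serreTilde h
  · obtain ⟨hs, hd⟩ := h.dual_of_locallyGZOrSyz n
      (Linkage.locallyGZOrSyz_of_cSyz h (Linkage.CSyz.of_isNthCSyzygyAux hi) hG)
    exact key.1 (L.extVanish_of_dual h n hs hd)
  · obtain ⟨hs, hd⟩ := h.dual_of_locallyGZOrSyz n (Linkage.locallyGZOrSyz_of_serreTilde h hi hG)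
    exact key.1 (L.extVanish_of_dual h n hs hd)
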